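/- arXiv:2507.05628 — 5 statements merged into one kernel-verified Lean document; each statement's English description precedes it below -/
import Mathlib

section
/- For every y in the sup-norm closure of 𝒦(M(T)) in C(T), the map Θ → ℝ, θ ↦ ⟨μ_θ, y⟩ − (1/2)⟨μ_θ, 𝒦μ_θ⟩, is continuous. If moreover 𝒦μ_θ = 𝒦μ_{θ₀} on T implies θ = θ₀, then Φ(θ) := ⟨μ_θ, 𝒦μ_{θ₀}⟩ − (1/2)⟨μ_θ, 𝒦μ_θ⟩ admits θ₀ as its unique maximum point over Θ. -/
open Filter MeasureTheory ProbabilityTheory Topology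

noncomputable section

/-- A symmetric positive-semidefinite operator `A : E* → E` annihilates every functional on which
its quadratic form vanishes. -/
lemma apply_eq_zero_of_quadratic_eq_zero {E : Type*} [NormedAddCommGroup E] [NormedSpace ℝ E]
    (A : (E →L[ℝ] ℝ) →L[ℝ] E) (hpos : ∀ μ : E →L[ℝ] ℝ, 0 ≤ μ (A μ))
    (hsym : ∀ μ ν : E →L[ℝ] ℝ, μ (A ν) = ν (A μ)) {δ : E →L[ℝ] ℝ} (hδ : δ (A δ) = 0)
    (ν : E →L[ℝ] ℝ) : ν (A δ) = 0 := by
  have hquad : ∀ t : ℝ, 0 ≤ ν (A ν) * (t * t) + 2 * ν (A δ) * t + 0 := fun t => by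
    have h := hpos (δ + t • ν)
    simp only [map_add, map_smul, add_apply, smul_apply,
      smul_eq_mul, hδ, hsym δ ν] at h
    linarith
  have hdiscrim := discrim_le_zero hquad
  rw [discrim] at hdiscrim
  nlinarith [sq_nonneg (ν (A δ))]

/-- Completing the square for the contrast function of a symmetric operator `A : E* → E`. -/
lemma contrast_sub_contrast {E : Type*} [NormedAddCommGroup E] [NormedSpace ℝ E]
    (A : (E →L[ℝ] ℝ) →L[ℝ] E) (hsym : ∀ μ ν : E →L[ℝ] ℝ, μ (A ν) = ν (A μ))
    (μ ν : E →L[ℝ] ℝ) :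
    (ν (A ν) - (1 / 2) * ν (A ν)) - (μ (A ν) - (1 / 2) * μ (A μ)) =
      (1 / 2) * (μ - ν) (A (μ - ν)) := by
  simp only [map_sub, sub_apply, hsym ν μ]
  ring

/-- Proposition 3.8 / `ContinuousContrast_UniqueMaximum`.
With the parametric family `θ ↦ μ_θ ∈ M(T)` continuous on the compact set `Θ ⊂ ℝᵖ`:
for every `y` in the sup-norm closure of `𝒦(M(T))`, the map
`θ ↦ ⟨μ_θ, y⟩ − ½⟨μ_θ, 𝒦μ_θ⟩` is continuous on `Θ`; and if the identifiability
condition (`𝒦μ_θ = 𝒦μ_{θ₀}` pointwise on `T` implies `θ = θ₀`) holds, then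
`Φ(θ) = ⟨μ_θ, 𝒦μ_{θ₀}⟩ − ½⟨μ_θ, 𝒦μ_θ⟩` admits `θ₀` as its unique maximum point on `Θ`. -/
theorem stmt3 {a b : ℝ} (hab : a < b) {p : ℕ}
    (K : C(Set.Icc a b × Set.Icc a b, ℝ))
    (hKsymm : ∀ s t : Set.Icc a b, K (s, t) = K (t, s))
    (Kop : (C(Set.Icc a b, ℝ) →L[ℝ] ℝ) →L[ℝ] C(Set.Icc a b, ℝ))
    (hKop : ∀ (μ : C(Set.Icc a b, ℝ) →L[ℝ] ℝ) (s : Set.Icc a b), Kop μ s = μ (K.curry s))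
    (hpos : ∀ μ : C(Set.Icc a b, ℝ) →L[ℝ] ℝ, 0 ≤ μ (Kop μ))
    (hsym : ∀ μ ν : C(Set.Icc a b, ℝ) →L[ℝ] ℝ, μ (Kop ν) = ν (Kop μ))
    (Θ : Set (Fin p → ℝ)) (hΘc : IsCompact Θ)
    (θ₀ : Fin p → ℝ) (hθ₀ : θ₀ ∈ Θ)
    (μf : (Fin p → ℝ) → (C(Set.Icc a b, ℝ) →L[ℝ] ℝ))
    (hcont : ContinuousOn μf Θ) :
    (∀ y ∈ closure (Set.range Kop),
        ContinuousOn (fun θ => (μf θ) y - (1 / 2) * (μf θ) (Kop (μf θ))) Θ) ∧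
      ((∀ θ ∈ Θ, (∀ s : Set.Icc a b, Kop (μf θ) s = Kop (μf θ₀) s) → θ = θ₀) →
        (∀ θ ∈ Θ,
            (μf θ) (Kop (μf θ₀)) - (1 / 2) * (μf θ) (Kop (μf θ)) ≤
              (μf θ₀) (Kop (μf θ₀)) - (1 / 2) * (μf θ₀) (Kop (μf θ₀))) ∧
          ∀ θ ∈ Θ,
            (μf θ) (Kop (μf θ₀)) - (1 / 2) * (μf θ) (Kop (μf θ)) =
                (μf θ₀) (Kop (μf θ₀)) - (1 / 2) * (μf θ₀) (Kop (μf θ₀)) →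
              θ = θ₀) := by
  refine ⟨fun y _ => ?_, fun hident => ⟨fun θ _ => ?_, fun θ hθ heq => ?_⟩⟩
  · exact (hcont.clm_apply continuousOn_const).sub
      (continuousOn_const.mul (hcont.clm_apply (Kop.continuous.comp_continuousOn hcont)))
  · have h := contrast_sub_contrast Kop hsym (μf θ) (μf θ₀)
    linarith [hpos (μf θ - μf θ₀)]
  · refine hident θ hθ fun s => ?_
    have h := contrast_sub_contrast Kop hsym (μf θ) (μf θ₀)
    have hzero : (μf θ - μf θ₀) (Kop (μf θ - μf θ₀)) = 0 := by linarith
    have heval := apply_eq_zero_of_quadratic_eq_zero Kop hpos hsym hzero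
      (ContinuousMap.evalCLM ℝ s)
    rw [map_sub, map_sub] at heval
    exact sub_eq_zero.mp heval
end
end

section
/- Define J_ε := ∫₀¹ ∇²_θΦ_ε((1 − u)θ₀ + u θ̂_ε) du, a random p×p matrix (here ∇²_θ is the matrix of second-order partial derivatives in θ). Then J_ε → −Σ in probability as ε → 0, where Σ is the p×p matrix with entries Σ_ij = ⟨∂_iμ_{θ₀}, 𝒦∂_jμ_{θ₀}⟩. -/
open Filter MeasureTheory ProbabilityTheory Topology

noncomputable section

/-- The continuous linear map `ℝᵖ →L M(T)` determined by the partial derivatives `v i`. -/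
def clmOfPartials {a b : ℝ} {p : ℕ} (v : Fin p → (C(Set.Icc a b, ℝ) →L[ℝ] ℝ)) :
    EuclideanSpace ℝ (Fin p) →L[ℝ] (C(Set.Icc a b, ℝ) →L[ℝ] ℝ) :=
  ∑ i, (EuclideanSpace.proj i).smulRight (v i)

section Covariance

variable {E : Type*} [NormedAddCommGroup E] [NormedSpace ℝ E]

/-- Degenerate directions of a symmetric positive operator are in its kernel. -/
theorem apply_eq_zero_of_apply_self_eq_zero (A : (E →L[ℝ] ℝ) →L[ℝ] E)
    (hpos : ∀ μ : E →L[ℝ] ℝ, 0 ≤ μ (A μ)) (hsym : ∀ μ ν : E →L[ℝ] ℝ, μ (A ν) = ν (A μ))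
    {ν : E →L[ℝ] ℝ} (hν : ν (A ν) = 0) (l : E →L[ℝ] ℝ) : l (A ν) = 0 := by
  have h := discrim_le_zero (a := l (A l)) (b := 2 * l (A ν)) (c := 0) fun t => by
    have := hpos (ν + t • l)
    simp only [map_add, map_smul, add_apply, smul_apply,
      smul_eq_mul, hν, hsym ν l] at this
    linarith
  rw [discrim] at h
  have : l (A ν) ^ 2 ≤ 0 := by nlinarith
  exact pow_eq_zero_iff two_ne_zero |>.1 (le_antisymm this (sq_nonneg _))

/-- A parameter whose perturbed contrast is at least that of the true parameter is close to the
true parameter when the perturbation is small. -/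
theorem exists_forall_dist_lt_of_contrast_le {M : Type*} [PseudoMetricSpace M]
    (A : (E →L[ℝ] ℝ) →L[ℝ] E)
    (hpos : ∀ μ : E →L[ℝ] ℝ, 0 ≤ μ (A μ)) (hsym : ∀ μ ν : E →L[ℝ] ℝ, μ (A ν) = ν (A μ))
    {S : Set M} (hS : IsCompact S) {θ₀ : M} {m : M → E →L[ℝ] ℝ} (hm : ContinuousOn m S)
    (hident : ∀ θ ∈ S, (∀ l : E →L[ℝ] ℝ, l (A (m θ)) = l (A (m θ₀))) → θ = θ₀)
    {δ : ℝ} (hδ : 0 < δ) :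
    ∃ η > 0, ∀ x : E, ‖x‖ < η → ∀ θ ∈ S,
      m θ₀ (A (m θ₀) + x) - (1 / 2) * m θ₀ (A (m θ₀)) ≤
        m θ (A (m θ₀) + x) - (1 / 2) * m θ (A (m θ)) → dist θ θ₀ < δ := by
  have hcompact : IsCompact (S \ Metric.ball θ₀ δ) := hS.diff Metric.isOpen_ball
  have hdiff : ContinuousOn (fun θ => m θ - m θ₀) S := hm.sub continuousOn_const
  obtain ⟨C, hC⟩ := hS.exists_bound_of_continuousOn hdiff
  rcases (S \ Metric.ball θ₀ δ).eq_empty_or_nonempty with hempty | hne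
  · refine ⟨1, one_pos, fun x _ θ hθ _ => ?_⟩
    by_contra h
    exact Set.eq_empty_iff_forall_notMem.1 hempty θ ⟨hθ, h⟩
  have hgap : ContinuousOn (fun θ => (m θ - m θ₀) (A (m θ - m θ₀))) (S \ Metric.ball θ₀ δ) :=
    (hdiff.clm_apply (A.continuous.comp_continuousOn hdiff)).mono Set.sdiff_subset
  obtain ⟨θ₁, hθ₁, hmin⟩ := hcompact.exists_isMinOn hne hgap
  set g := (m θ₁ - m θ₀) (A (m θ₁ - m θ₀)) with hg
  have hgpos : 0 < g := by
    refine lt_of_le_of_ne (hpos _) fun h => hθ₁.2 ?_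
    have : θ₁ = θ₀ := hident θ₁ hθ₁.1 fun l => by
      have := apply_eq_zero_of_apply_self_eq_zero A hpos hsym h.symm l
      rwa [map_sub, map_sub, sub_eq_zero] at this
    simpa [this] using hδ
  refine ⟨g / (2 * (|C| + 1)), by positivity, fun x hx θ hθ hle => ?_⟩
  by_contra hfar
  have hgθ : g ≤ (m θ - m θ₀) (A (m θ - m θ₀)) := hmin ⟨hθ, hfar⟩
  have hup : (m θ - m θ₀) (A (m θ - m θ₀)) ≤ 2 * (m θ - m θ₀) x := by
    have := hsym (m θ) (m θ₀)
    simp only [map_sub, map_add, sub_apply] at hle ⊢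
    linarith
  have hnorm : (m θ - m θ₀) x ≤ (|C| + 1) * ‖x‖ :=
    (le_abs_self _).trans <| ((m θ - m θ₀).le_opNorm x).trans <| by
      gcongr
      linarith [hC θ hθ, le_abs_self C]
  rw [lt_div_iff₀ (by positivity)] at hx
  linarith

end Covariance

/-- The sup norm of a weakly measurable random continuous function is measurable. -/
theorem measurable_norm_of_measurable_eval {X Ω : Type*} [TopologicalSpace X] [CompactSpace X]
    [TopologicalSpace.SeparableSpace X] [MeasurableSpace Ω] {Z : Ω → C(X, ℝ)}
    (hZ : ∀ t, Measurable fun ω => Z ω t) : Measurable fun ω => ‖Z ω‖ := by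
  refine measurable_of_Iic fun c => ?_
  rcases lt_or_ge c 0 with hc | hc
  · convert MeasurableSet.empty
    ext ω
    simpa using hc.trans_le (norm_nonneg (Z ω))
  obtain ⟨D, hDc, hD⟩ := TopologicalSpace.exists_countable_dense X
  have : (fun ω => ‖Z ω‖) ⁻¹' Set.Iic c = ⋂ t ∈ D, {ω | ‖Z ω t‖ ≤ c} := by
    ext ω
    simp only [Set.mem_preimage, Set.mem_Iic, Set.mem_iInter, Set.mem_ofPred_eq,
      ContinuousMap.norm_le _ hc]
    refine ⟨fun h t _ => h t, fun h t => ?_⟩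
    exact (isClosed_le (Z ω).continuous.norm continuous_const).closure_subset_iff.2
      (show D ⊆ {t | ‖Z ω t‖ ≤ c} from h) (hD t)
  rw [this]
  exact MeasurableSet.biInter hDc fun t _ => measurableSet_le (hZ t).norm measurable_const

theorem tendsto_measure_le_mul_nhdsGT_zero {Ω : Type*} [MeasurableSpace Ω] (P : Measure Ω)
    [IsFiniteMeasure P] {f : Ω → ℝ} (hf : Measurable f) {η : ℝ} (hη : 0 < η) :
    Tendsto (fun ε : ℝ => P {ω | η ≤ ε * f ω}) (𝓝[>] 0) (𝓝 0) := by
  have h := tendsto_measure_iInter_atTop (μ := P) (s := fun r : ℝ => {ω | r ≤ f ω})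
    (fun r => (measurableSet_le measurable_const hf).nullMeasurableSet)
    (fun r s hrs ω hω => le_trans hrs hω) ⟨0, measure_ne_top _ _⟩
  have hempty : ⋂ r : ℝ, {ω | r ≤ f ω} = ∅ := by
    refine Set.eq_empty_iff_forall_notMem.2 fun ω hω => ?_
    have : f ω + 1 ≤ f ω := Set.mem_iInter.1 hω (f ω + 1)
    linarith
  rw [hempty, measure_empty] at h
  refine (h.comp (tendsto_inv_nhdsGT_zero.const_mul_atTop hη)).congr' ?_
  filter_upwards [self_mem_nhdsWithin] with ε hε
  have hε : 0 < ε := hε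
  change P {ω | η * ε⁻¹ ≤ f ω} = _
  simp only [← div_eq_mul_inv, div_le_iff₀ hε, mul_comm ε]

/-- Averaging along a segment from `θ₀` a function that is within `δ` of `c` on the part of a
convex set near `θ₀` gives a value within `δ` of `c`. -/
theorem abs_intervalIntegral_segment_sub_le {V : Type*} [NormedAddCommGroup V] [NormedSpace ℝ V]
    {S : Set V} (hS : Convex ℝ S) {θ₀ θ : V} (hθ₀ : θ₀ ∈ S) (hθ : θ ∈ S) {F : V → ℝ}
    (hF : ContinuousOn F S) {c δ r : ℝ} (hr : dist θ θ₀ < r)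
    (hFc : ∀ θ' ∈ S, dist θ' θ₀ < r → |F θ' - c| ≤ δ) :
    |(∫ u in (0 : ℝ)..1, F (θ₀ + u • (θ - θ₀))) - c| ≤ δ := by
  have hseg : ∀ u ∈ Set.Icc (0 : ℝ) 1, θ₀ + u • (θ - θ₀) ∈ S := fun u hu =>
    hS.add_smul_sub_mem hθ₀ hθ hu
  have hint : IntervalIntegrable (fun u : ℝ => F (θ₀ + u • (θ - θ₀))) volume 0 1 := by
    refine ContinuousOn.intervalIntegrable ?_
    rw [Set.uIcc_of_le zero_le_one]
    exact hF.comp (by fun_prop) hseg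
  have hsub : (∫ u in (0 : ℝ)..1, F (θ₀ + u • (θ - θ₀))) - c =
      ∫ u in (0 : ℝ)..1, (F (θ₀ + u • (θ - θ₀)) - c) := by
    rw [intervalIntegral.integral_sub hint intervalIntegrable_const]
    simp
  rw [hsub]
  suffices h : ∀ u ∈ Set.uIoc (0 : ℝ) 1, ‖F (θ₀ + u • (θ - θ₀)) - c‖ ≤ δ by
    simpa using intervalIntegral.norm_integral_le_of_norm_le_const h
  intro u hu
  rw [Set.uIoc_of_le zero_le_one] at hu
  refine hFc _ (hseg u ⟨hu.1.le, hu.2⟩) (lt_of_le_of_lt ?_ hr)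
  rw [dist_eq_norm, dist_eq_norm, add_sub_cancel_left, norm_smul, Real.norm_of_nonneg hu.1.le]
  exact mul_le_of_le_one_left (norm_nonneg _) hu.2

/-- Lemma 3.15 / `J_epsilon_convergence`.
`J_ε := ∫₀¹ ∇²Φ_ε((1−u)θ₀ + uθ̂_ε) du`, with `∇²Φ_ε(θ)ᵢⱼ
 = ⟨∂ᵢ∂ⱼμ_θ, X^ε⟩ − ⟨∂ᵢ∂ⱼμ_θ, 𝒦μ_θ⟩ − ⟨∂ᵢμ_θ, 𝒦∂ⱼμ_θ⟩`, where `θ̂_ε` maximizes the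
contrast `Φ_ε(θ) = ⟨μ_θ, X^ε⟩ − ½⟨μ_θ, 𝒦μ_θ⟩` over the compact convex `Θ` (with `θ₀`
interior, `θ ↦ μ_θ` continuous and of class `C²(Θ; M(T))`, identifiability).  Then
`J_ε → −Σ` in probability as `ε → 0`, where `Σᵢⱼ = ⟨∂ᵢμ_{θ₀}, 𝒦∂ⱼμ_{θ₀}⟩`. -/
theorem stmt6 {a b : ℝ} (hab : a < b) {p : ℕ}
    {Ω : Type*} [MeasurableSpace Ω] (P : Measure Ω) [IsProbabilityMeasure P]
    (K : C(Set.Icc a b × Set.Icc a b, ℝ))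
    (hKsymm : ∀ s t : Set.Icc a b, K (s, t) = K (t, s))
    (Kop : (C(Set.Icc a b, ℝ) →L[ℝ] ℝ) →L[ℝ] C(Set.Icc a b, ℝ))
    (hKop : ∀ (μ : C(Set.Icc a b, ℝ) →L[ℝ] ℝ) (s : Set.Icc a b), Kop μ s = μ (K.curry s))
    (hpos : ∀ μ : C(Set.Icc a b, ℝ) →L[ℝ] ℝ, 0 ≤ μ (Kop μ))
    (hsym : ∀ μ ν : C(Set.Icc a b, ℝ) →L[ℝ] ℝ, μ (Kop ν) = ν (Kop μ))
    (Z : Ω → C(Set.Icc a b, ℝ))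
    (hZmeas : ∀ ν : C(Set.Icc a b, ℝ) →L[ℝ] ℝ, Measurable fun ω => ν (Z ω))
    (hZgauss : ∀ ν : C(Set.Icc a b, ℝ) →L[ℝ] ℝ,
      P.map (fun ω => ν (Z ω)) = gaussianReal 0 (Real.toNNReal (ν (Kop ν))))
    (hZcov : ∀ μ ν : C(Set.Icc a b, ℝ) →L[ℝ] ℝ,
      ∫ ω, μ (Z ω) * ν (Z ω) ∂P = μ (Kop ν))
    (Θ : Set (EuclideanSpace ℝ (Fin p))) (hΘc : IsCompact Θ) (hΘconv : Convex ℝ Θ)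
    (θ₀ : EuclideanSpace ℝ (Fin p)) (hθ₀Θ : θ₀ ∈ Θ) (hθ₀ : θ₀ ∈ interior Θ)
    (μf : EuclideanSpace ℝ (Fin p) → (C(Set.Icc a b, ℝ) →L[ℝ] ℝ))
    (hcont : ContinuousOn μf Θ)
    (hident : ∀ θ ∈ Θ, (∀ s : Set.Icc a b, Kop (μf θ) s = Kop (μf θ₀) s) → θ = θ₀)
    (Dμ : EuclideanSpace ℝ (Fin p) → Fin p → (C(Set.Icc a b, ℝ) →L[ℝ] ℝ))
    (D2μ : EuclideanSpace ℝ (Fin p) → Fin p → Fin p → (C(Set.Icc a b, ℝ) →L[ℝ] ℝ))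
    (hD1 : ∀ θ ∈ Θ, HasFDerivWithinAt μf (clmOfPartials (Dμ θ)) Θ θ)
    (hD2 : ∀ θ ∈ Θ, ∀ i, HasFDerivWithinAt (fun θ' => Dμ θ' i)
      (clmOfPartials (fun j => D2μ θ j i)) Θ θ)
    (hD2cont : UniformContinuousOn D2μ Θ)
    (θhat : ℝ → Ω → EuclideanSpace ℝ (Fin p))
    (hθmeas : ∀ ε, Measurable (θhat ε))
    (hmem : ∀ ε > (0 : ℝ), ∀ ω, θhat ε ω ∈ Θ)
    (hargmax : ∀ ε > (0 : ℝ), ∀ ω, ∀ θ ∈ Θ,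
      (μf θ) (Kop (μf θ₀) + ε • Z ω) - (1 / 2) * (μf θ) (Kop (μf θ)) ≤
        (μf (θhat ε ω)) (Kop (μf θ₀) + ε • Z ω) -
          (1 / 2) * (μf (θhat ε ω)) (Kop (μf (θhat ε ω)))) :
    TendstoInMeasure P
      (fun (ε : ℝ) (ω : Ω) => fun (i j : Fin p) =>
        ∫ u in (0 : ℝ)..1,
          (fun θ' : EuclideanSpace ℝ (Fin p) =>
              (D2μ θ' i j) (Kop (μf θ₀) + ε • Z ω) - (D2μ θ' i j) (Kop (μf θ')) -
                (Dμ θ' i) (Kop (Dμ θ' j)))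
            (θ₀ + u • (θhat ε ω - θ₀)))
      (𝓝[>] 0)
      (fun _ω => fun i j => -(Dμ θ₀ i) (Kop (Dμ θ₀ j))) := by
  have hD1c : ∀ i, ContinuousOn (fun θ => Dμ θ i) Θ := fun i θ hθ =>
    (hD2 θ hθ i).continuousWithinAt
  have hD2c : ∀ i j, ContinuousOn (fun θ => D2μ θ i j) Θ := fun i j =>
    (continuous_apply_apply i j).comp_continuousOn hD2cont.continuousOn
  set F : Fin p → Fin p → C(Set.Icc a b, ℝ) × EuclideanSpace ℝ (Fin p) → ℝ := fun i j q =>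
    D2μ q.2 i j (Kop (μf θ₀) + q.1) - D2μ q.2 i j (Kop (μf q.2)) - Dμ q.2 i (Kop (Dμ q.2 j)) with hF
  have hFc : ∀ i j, ContinuousOn (F i j) (Set.univ ×ˢ Θ) := fun i j => by
    have hsnd : Set.MapsTo Prod.snd (Set.univ (α := C(Set.Icc a b, ℝ)) ×ˢ Θ) Θ := fun q hq => hq.2
    have h1 := (hD1c i).comp continuousOn_snd hsnd
    have h1' := Kop.continuous.comp_continuousOn ((hD1c j).comp continuousOn_snd hsnd)
    have h2 := (hD2c i j).comp continuousOn_snd hsnd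
    have h0 := Kop.continuous.comp_continuousOn (hcont.comp continuousOn_snd hsnd)
    exact ((h2.clm_apply (continuousOn_const.add continuousOn_fst)).sub
      (h2.clm_apply h0)).sub (h1.clm_apply h1')
  have hF0 : ∀ i j, F i j (0, θ₀) = -(Dμ θ₀ i) (Kop (Dμ θ₀ j)) := fun i j => by simp [hF]
  rw [tendstoInMeasure_iff_dist]
  intro δ hδ
  have hnear : ∃ r > 0, ∀ i j, ∀ x : C(Set.Icc a b, ℝ), ‖x‖ < r → ∀ θ ∈ Θ, dist θ θ₀ < r →
      |F i j (x, θ) - -(Dμ θ₀ i) (Kop (Dμ θ₀ j))| ≤ δ / 2 := by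
    have hev : ∀ᶠ q in 𝓝[Set.univ ×ˢ Θ] ((0 : C(Set.Icc a b, ℝ)), θ₀),
        ∀ i j, |F i j q - -(Dμ θ₀ i) (Kop (Dμ θ₀ j))| < δ / 2 := by
      refine eventually_all.2 fun i => eventually_all.2 fun j => ?_
      have h := hFc i j (0, θ₀) ⟨trivial, hθ₀Θ⟩
      rw [ContinuousWithinAt, hF0] at h
      exact (Metric.tendsto_nhds.1 h) _ (half_pos hδ)
    obtain ⟨r, hr, hball⟩ := Metric.mem_nhdsWithin_iff.1 hev
    refine ⟨r, hr, fun i j x hx θ hθ hd => (hball ⟨?_, trivial, hθ⟩ i j).le⟩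
    rw [Metric.mem_ball, Prod.dist_eq, max_lt_iff, dist_zero_right]
    exact ⟨hx, hd⟩
  obtain ⟨r, hr, hnear⟩ := hnear
  obtain ⟨η, hη, hclose⟩ := exists_forall_dist_lt_of_contrast_le Kop hpos hsym hΘc hcont
    (θ₀ := θ₀) (fun θ hθ h => hident θ hθ fun s => h (ContinuousMap.evalCLM ℝ s)) hr
  have hnorm : Measurable fun ω => ‖Z ω‖ :=
    measurable_norm_of_measurable_eval fun t => hZmeas (ContinuousMap.evalCLM ℝ t)
  refine tendsto_of_tendsto_of_tendsto_of_le_of_le' tendsto_const_nhds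
    (tendsto_measure_le_mul_nhdsGT_zero P hnorm (lt_min hη hr))
    (Eventually.of_forall fun _ => zero_le) ?_
  filter_upwards [self_mem_nhdsWithin] with ε hε
  have hε : 0 < ε := hε
  refine measure_mono fun ω hω => ?_
  by_contra hsmall
  have hx : ‖ε • Z ω‖ < min η r := by
    rw [norm_smul, Real.norm_of_nonneg hε.le]
    exact not_le.1 hsmall
  have hd := hclose _ (hx.trans_le (min_le_left _ _)) _ (hmem ε hε ω) (hargmax ε hε ω θ₀ hθ₀Θ)
  refine absurd hω (not_le.2 (lt_of_le_of_lt ?_ (half_lt_self hδ)))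
  refine (dist_pi_le_iff (half_pos hδ).le).2 fun i => (dist_pi_le_iff (half_pos hδ).le).2 fun j => ?_
  exact abs_intervalIntegral_segment_sub_le hΘconv hθ₀Θ (hmem ε hε ω)
    (F := fun θ => F i j (ε • Z ω, θ))
    ((hFc i j).comp (by fun_prop) fun θ hθ => ⟨trivial, hθ⟩) hd
    (fun θ hθ => hnear i j _ (hx.trans_le (min_le_right _ _)) θ hθ)
end
end

section
/- As ε → 0, ε⁻¹(θ̂_ε − θ₀) → Σ⁻¹⟨∇_θμ_{θ₀}, Z⟩ in probability, where ⟨∇_θμ_{θ₀}, Z⟩ denotes the random vector (⟨∂_iμ_{θ₀}, Z⟩)_{1≤i≤p}; moreover the limit random vector Σ⁻¹⟨∇_θμ_{θ₀}, Z⟩ has the centered multivariate normal distribution N(0, Σ⁻¹) on ℝᵖ. -/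
open Filter MeasureTheory ProbabilityTheory Topology Matrix

noncomputable section

/-- A map into a compact set along which a continuous function vanishing only at `x₀` tends to
zero must converge to `x₀`. -/
lemma tendsto_of_tendsto_zero_of_isCompact {X ι : Type*} [TopologicalSpace X] {l : Filter ι}
    {s : Set X} (hs : IsCompact s) {Q : X → ℝ} (hQ : ContinuousOn Q s) {x₀ : X}
    (hpos : ∀ x ∈ s, x ≠ x₀ → 0 < Q x) {t : ι → X} (ht : ∀ᶠ i in l, t i ∈ s)
    (hlim : Tendsto (fun i => Q (t i)) l (𝓝 0)) : Tendsto t l (𝓝 x₀) := by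
  refine tendsto_nhds.2 fun U hU hx₀ => ?_
  obtain ⟨m, hm, hmle⟩ := (hs.diff hU).exists_forall_le' (hQ.mono Set.sdiff_subset) (a := 0)
    fun x hx => hpos x hx.1 fun h => hx.2 (h ▸ hx₀)
  filter_upwards [ht, hlim.eventually (gt_mem_nhds hm)] with i hi hlt
  by_contra hnot
  exact (hmle (t i) ⟨hi, hnot⟩).not_gt hlt

/-- The Cauchy–Schwarz inequality for a symmetric positive semidefinite continuous bilinear form. -/
lemma sq_apply_le_of_symm_of_nonneg {M : Type*} [NormedAddCommGroup M] [NormedSpace ℝ M]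
    {B : M →L[ℝ] M →L[ℝ] ℝ} (hsymm : ∀ x y, B x y = B y x) (hnonneg : ∀ x, 0 ≤ B x x)
    (x y : M) : B x y ^ 2 ≤ B x x * B y y := by
  have h := discrim_le_zero (a := B y y) (b := 2 * B x y) (c := B x x) fun r => by
    have := hnonneg (x + r • y)
    simp only [map_add, map_smul, _root_.add_apply, _root_.smul_apply,
      smul_eq_mul, hsymm y x] at this
    linarith
  rw [discrim] at h
  linarith

section ContrastExpansion

open Asymptotics

variable {E M : Type*} [NormedAddCommGroup E] [NormedSpace ℝ E] [NormedAddCommGroup M]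
  [NormedSpace ℝ M]

/-- A positive semidefinite form `B` is coercive along `D` as soon as the Gram form
`(g, h) ↦ B (D g) (D h)` dominates `‖h‖²` through a bounded operator `S`. -/
lemma exists_coercive_of_gram_inverse {B : M →L[ℝ] M →L[ℝ] ℝ}
    (hsymm : ∀ x y, B x y = B y x) (hnonneg : ∀ x, 0 ≤ B x x) (D : E →L[ℝ] M) (S : E →L[ℝ] E)
    (hS : ∀ h, B (D (S h)) (D h) = ‖h‖ ^ 2) :
    ∃ c > 0, ∀ h, c * ‖h‖ ^ 2 ≤ B (D h) (D h) := by
  set L := D.comp S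
  refine ⟨(‖B‖ * ‖L‖ * ‖L‖ + 1)⁻¹, by positivity, fun h => ?_⟩
  rw [inv_mul_le_iff₀ (by positivity)]
  rcases eq_or_ne h 0 with rfl | hh
  · simp
  have hpos : 0 < ‖h‖ ^ 2 := by positivity
  have hcs := sq_apply_le_of_symm_of_nonneg hsymm hnonneg (D (S h)) (D h)
  rw [hS h] at hcs
  have hL : B (D (S h)) (D (S h)) ≤ ‖B‖ * ‖L‖ * ‖L‖ * ‖h‖ ^ 2 := calc
    B (L h) (L h) ≤ ‖B (L h) (L h)‖ := Real.le_norm_self _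
    _ ≤ ‖B‖ * ‖L h‖ * ‖L h‖ := B.le_opNorm₂ _ _
    _ ≤ ‖B‖ * (‖L‖ * ‖h‖) * (‖L‖ * ‖h‖) := by gcongr <;> exact L.le_opNorm h
    _ = ‖B‖ * ‖L‖ * ‖L‖ * ‖h‖ ^ 2 := by ring
  have hq := hnonneg (D h)
  have : ‖h‖ ^ 2 * ‖h‖ ^ 2 ≤ ‖h‖ ^ 2 * (‖B‖ * ‖L‖ * ‖L‖ * B (D h) (D h)) := by
    nlinarith [mul_le_mul_of_nonneg_right hL hq]
  linarith [le_of_mul_le_mul_left this hpos]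

/-- First-order expansion of a quadratic functional of a differentiable map. -/
lemma HasFDerivAt.isLittleO_quadratic_sub {B : M →L[ℝ] M →L[ℝ] ℝ}
    (hsymm : ∀ x y, B x y = B y x) {f : E → M} {D : E →L[ℝ] M} {x₀ : E}
    (hf : HasFDerivAt f D x₀) :
    (fun x => B (f x - f x₀) (f x - f x₀) - B (D (x - x₀)) (D (x - x₀)))
      =o[𝓝 x₀] fun x => ‖x - x₀‖ ^ 2 := by
  have hsum : (fun x => f x - f x₀ + D (x - x₀)) =O[𝓝 x₀] fun x => x - x₀ :=
    hf.isBigO_sub.add (D.isBigO_sub _ _)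
  have hprod := hf.isLittleO.norm_norm.mul_isBigO hsum.norm_norm
  refine IsBigO.trans_isLittleO (g := fun x =>
    ‖f x - f x₀ - D (x - x₀)‖ * ‖f x - f x₀ + D (x - x₀)‖) ?_ (by simpa only [sq] using hprod)
  refine IsBigO.of_bound ‖B‖ (Eventually.of_forall fun x => ?_)
  have hdiff : B (f x - f x₀) (f x - f x₀) - B (D (x - x₀)) (D (x - x₀)) =
      B (f x - f x₀ - D (x - x₀)) (f x - f x₀ + D (x - x₀)) := by
    generalize f x - f x₀ = y
    generalize D (x - x₀) = w
    rw [map_sub, _root_.sub_apply, map_add, map_add, hsymm w y]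
    ring
  rw [hdiff, norm_mul, norm_norm, norm_norm, ← mul_assoc]
  exact B.le_opNorm₂ _ _

/-- Maximizers of `2 ε z(f x - f x₀) - B(f x - f x₀, f x - f x₀)` which converge to `x₀` satisfy
`ε⁻¹ (t ε - x₀) → u`, where `u` maximizes the linearized criterion. -/
lemma tendsto_rescaled_argmax {B : M →L[ℝ] M →L[ℝ] ℝ} (hsymm : ∀ x y, B x y = B y x)
    {f : E → M} {D : E →L[ℝ] M} {x₀ : E} (hf : HasFDerivAt f D x₀) {c : ℝ} (hc : 0 < c)
    (hcoer : ∀ h, c * ‖h‖ ^ 2 ≤ B (D h) (D h)) (z : M →L[ℝ] ℝ) {u : E}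
    (hu : ∀ h, B (D h) (D u) = z (D h)) {t : ℝ → E} (ht : Tendsto t (𝓝[>] 0) (𝓝 x₀))
    (hmax : ∀ᶠ x in 𝓝 x₀, ∀ ε > 0,
      2 * ε * z (f x - f x₀) - B (f x - f x₀) (f x - f x₀) ≤
        2 * ε * z (f (t ε) - f x₀) - B (f (t ε) - f x₀) (f (t ε) - f x₀)) :
    Tendsto (fun ε => ε⁻¹ • (t ε - x₀)) (𝓝[>] 0) (𝓝 u) := by
  have hquad := hf.isLittleO_quadratic_sub hsymm
  have hrate : (fun ε => t ε - x₀) =O[𝓝[>] 0] fun ε => ε := by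
    obtain ⟨C, hC0, hC⟩ := (hf.isBigO_sub.comp_tendsto ht).exists_nonneg
    refine IsBigO.of_bound (4 * ‖z‖ * C / c) ?_
    filter_upwards [hC.bound, (hquad.comp_tendsto ht).bound (half_pos hc), self_mem_nhdsWithin]
      with ε hCε hqε hε
    have hε : 0 < ε := hε
    simp only [Function.comp_apply, norm_pow, norm_norm] at hCε hqε
    have h0 := hmax.self_of_nhds ε hε
    simp only [sub_self, map_zero, mul_zero] at h0
    have hz : z (f (t ε) - f x₀) ≤ ‖z‖ * (C * ‖t ε - x₀‖) :=
      (Real.le_norm_self _).trans ((z.le_opNorm _).trans (by gcongr))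
    have hz' := mul_le_mul_of_nonneg_left hz (by positivity : 0 ≤ 2 * ε)
    have hco := hcoer (t ε - x₀)
    have hq' := neg_le_of_abs_le hqε
    rw [Real.norm_of_nonneg hε.le]
    rcases (norm_nonneg (t ε - x₀)).eq_or_lt' with h | h
    · rw [h]
      positivity
    · rw [div_mul_eq_mul_div, le_div_iff₀ hc]
      refine le_of_mul_le_mul_right ?_ h
      nlinarith
  have hrem : ∀ s : ℝ → E, Tendsto s (𝓝[>] 0) (𝓝 x₀) →
      ((fun ε => s ε - x₀) =O[𝓝[>] 0] fun ε => ε) →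
      (fun ε => 2 * ε * z (f (s ε) - f x₀ - D (s ε - x₀)) -
        (B (f (s ε) - f x₀) (f (s ε) - f x₀) - B (D (s ε - x₀)) (D (s ε - x₀))))
        =o[𝓝[>] 0] fun ε => ε ^ 2 := by
    intro s hs hsO
    refine IsLittleO.sub ?_ ((hquad.comp_tendsto hs).trans_isBigO (hsO.norm_left.pow 2))
    have hlin := (hf.isLittleO.comp_tendsto hs).trans_isBigO hsO
    have hz := (z.isBigO_comp (fun ε => f (s ε) - f x₀ - D (s ε - x₀)) _).trans_isLittleO hlin
    have h2 : (fun ε : ℝ => 2 * ε) =O[𝓝[>] 0] fun ε => ε := isBigO_const_mul_self _ _ _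
    simpa only [sq] using h2.mul_isLittleO hz
  have hline : Tendsto (fun ε : ℝ => x₀ + ε • u) (𝓝[>] 0) (𝓝 x₀) := by
    have : Tendsto (fun ε : ℝ => x₀ + ε • u) (𝓝 0) (𝓝 (x₀ + (0 : ℝ) • u)) :=
      Continuous.tendsto (by fun_prop) 0
    rw [zero_smul, add_zero] at this
    exact this.mono_left nhdsWithin_le_nhds
  have hlineO : (fun ε : ℝ => x₀ + ε • u - x₀) =O[𝓝[>] 0] fun ε => ε := by
    refine IsBigO.of_bound ‖u‖ (Eventually.of_forall fun ε => ?_)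
    rw [add_sub_cancel_left, norm_smul, mul_comm]
  have hgap := (hrem t ht hrate).sub (hrem _ hline hlineO)
  have hsq : (fun ε => ‖ε • u - (t ε - x₀)‖ ^ 2) =o[𝓝[>] 0] fun ε : ℝ => ε ^ 2 := by
    refine IsBigO.trans_isLittleO (IsBigO.of_bound c⁻¹ ?_) hgap
    filter_upwards [hline.eventually hmax, self_mem_nhdsWithin] with ε hm hε
    have hm := hm ε hε
    have hco := hcoer (ε • u - (t ε - x₀))
    rw [norm_pow, norm_norm, ← div_eq_inv_mul, le_div_iff₀' hc]
    refine (hco.trans ?_).trans (Real.le_norm_self _)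
    have hexp : B (D (ε • u - (t ε - x₀))) (D (ε • u - (t ε - x₀))) =
        ε ^ 2 * B (D u) (D u) - 2 * ε * z (D (t ε - x₀)) + B (D (t ε - x₀)) (D (t ε - x₀)) := by
      rw [← hu]
      generalize t ε - x₀ = h
      simp only [map_sub, map_smul, _root_.sub_apply, _root_.smul_apply,
        smul_eq_mul, hsymm (D u) (D h)]
      ring
    have hDu : B (D (ε • u)) (D (ε • u)) = ε ^ 2 * B (D u) (D u) := by
      simp only [map_smul, _root_.smul_apply, smul_eq_mul]
      ring
    have hzu : z (D (ε • u)) = ε * B (D u) (D u) := by rw [map_smul, map_smul, ← hu, smul_eq_mul]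
    rw [hexp]
    simp only [add_sub_cancel_left, map_sub z] at hm ⊢
    rw [hDu, hzu]
    linarith
  have hlo : (fun ε => ‖ε • u - (t ε - x₀)‖) =o[𝓝[>] 0] fun ε : ℝ => ε :=
    IsLittleO.of_pow hsq two_ne_zero
  rw [tendsto_iff_norm_sub_tendsto_zero]
  refine (hlo.tendsto_div_nhds_zero).congr' ?_
  filter_upwards [self_mem_nhdsWithin] with ε hε
  have hε : 0 < ε := hε
  rw [norm_sub_rev, div_eq_inv_mul, ← Real.norm_of_nonneg (inv_nonneg.2 hε.le), ← norm_smul,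
    smul_sub, smul_smul, Real.norm_of_nonneg (inv_nonneg.2 hε.le), inv_mul_cancel₀ hε.ne', one_smul,
    ← norm_sub_rev]

/-- Maximizers over a compact neighbourhood `s` of `x₀` of the criterion
`2 ε z(f x - f x₀) - B(f x - f x₀, f x - f x₀)` converge to `x₀` at rate `ε`, with limit `u`,
provided that `x₀` is identified by the noiseless criterion. -/
lemma tendsto_rescaled_argmax_of_isCompact {B : M →L[ℝ] M →L[ℝ] ℝ}
    (hsymm : ∀ x y, B x y = B y x) (hnonneg : ∀ x, 0 ≤ B x x) {s : Set E} (hs : IsCompact s)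
    {x₀ : E} (hx₀ : s ∈ 𝓝 x₀) {f : E → M} (hfs : ContinuousOn f s) {D : E →L[ℝ] M}
    (hf : HasFDerivAt f D x₀) (hident : ∀ x ∈ s, B (f x - f x₀) (f x - f x₀) = 0 → x = x₀)
    {c : ℝ} (hc : 0 < c) (hcoer : ∀ h, c * ‖h‖ ^ 2 ≤ B (D h) (D h)) (z : M →L[ℝ] ℝ) {u : E}
    (hu : ∀ h, B (D h) (D u) = z (D h)) {t : ℝ → E} (hts : ∀ ε > 0, t ε ∈ s)
    (hmax : ∀ ε > 0, ∀ x ∈ s,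
      2 * ε * z (f x - f x₀) - B (f x - f x₀) (f x - f x₀) ≤
        2 * ε * z (f (t ε) - f x₀) - B (f (t ε) - f x₀) (f (t ε) - f x₀)) :
    Tendsto (fun ε => ε⁻¹ • (t ε - x₀)) (𝓝[>] 0) (𝓝 u) := by
  refine tendsto_rescaled_argmax hsymm hf hc hcoer z hu ?_
    (Filter.mem_of_superset hx₀ fun x hx ε hε => hmax ε hε x hx)
  refine tendsto_of_tendsto_zero_of_isCompact hs
    (Q := fun x => B (f x - f x₀) (f x - f x₀)) (by fun_prop)
    (fun x hx hne => (hnonneg _).lt_of_ne' fun h => hne (hident x hx h))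
    (eventually_mem_nhdsWithin.mono hts) ?_
  obtain ⟨C, hC⟩ := hs.exists_bound_of_continuousOn (f := fun x => z (f x - f x₀)) (by fun_prop)
  have hlim : Tendsto (fun ε : ℝ => 2 * ε * C) (𝓝[>] 0) (𝓝 0) := by
    have : Tendsto (fun ε : ℝ => 2 * ε * C) (𝓝 0) (𝓝 (2 * 0 * C)) :=
      Continuous.tendsto (by fun_prop) 0
    rw [mul_zero, zero_mul] at this
    exact this.mono_left nhdsWithin_le_nhds
  refine squeeze_zero' (Eventually.of_forall fun _ => hnonneg _) ?_ hlim
  filter_upwards [self_mem_nhdsWithin] with ε hε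
  have hε : 0 < ε := hε
  have h := hmax ε hε x₀ (mem_of_mem_nhds hx₀)
  simp only [sub_self, map_zero, mul_zero] at h
  have hle : z (f (t ε) - f x₀) ≤ C := (Real.le_norm_self _).trans (hC _ (hts ε hε))
  have := mul_le_mul_of_nonneg_left hle (by positivity : 0 ≤ 2 * ε)
  linarith

end ContrastExpansion

lemma clmOfPartials_apply {a b : ℝ} {p : ℕ} (v : Fin p → (C(Set.Icc a b, ℝ) →L[ℝ] ℝ))
    (h : EuclideanSpace ℝ (Fin p)) (x : C(Set.Icc a b, ℝ)) :
    clmOfPartials v h x = h.ofLp ⬝ᵥ fun i => v i x := by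
  simp [clmOfPartials, dotProduct]

/-- The form `⟨·, 𝒦 ·⟩` along `clmOfPartials v` is given by the Gram matrix of `v`. -/
lemma clmOfPartials_gram {a b : ℝ} {p : ℕ} (v : Fin p → (C(Set.Icc a b, ℝ) →L[ℝ] ℝ))
    (Kop : (C(Set.Icc a b, ℝ) →L[ℝ] ℝ) →L[ℝ] C(Set.Icc a b, ℝ))
    {Sig : Matrix (Fin p) (Fin p) ℝ} (hSig : ∀ i j, Sig i j = v i (Kop (v j)))
    (g h : EuclideanSpace ℝ (Fin p)) :
    clmOfPartials v g (Kop (clmOfPartials v h)) = g.ofLp ⬝ᵥ Sig *ᵥ h.ofLp := by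
  rw [clmOfPartials_apply]
  congr 1
  ext i
  simp [clmOfPartials, mulVec, dotProduct, hSig, mul_comm]

/-- Theorem 3.12, asymptotic normality of the MLE under continuous
observation.  Under the assumptions of the paper (compact convex `Θ` with `θ₀` interior,
`θ ↦ μ_θ` continuous on `Θ` and of class `C²(Θ; M(T))`, identifiability, and
`Σᵢⱼ = ⟨∂ᵢμ_{θ₀}, 𝒦∂ⱼμ_{θ₀}⟩` invertible), the MLE `θ̂_ε` of the contrast
`Φ_ε(θ) = ⟨μ_θ, X^ε⟩ − ½⟨μ_θ, 𝒦μ_θ⟩`, `X^ε = 𝒦μ_{θ₀} + εZ`, satisfies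
`ε⁻¹(θ̂_ε − θ₀) → Σ⁻¹⟨∇μ_{θ₀}, Z⟩` in probability as `ε → 0`; moreover the limit
`Σ⁻¹⟨∇μ_{θ₀}, Z⟩` is a centered Gaussian vector with covariance `Σ⁻¹`, i.e. every linear
functional `u` of it is `N(0, uᵀΣ⁻¹u)`-distributed. -/
theorem stmt7 {a b : ℝ} (hab : a < b) {p : ℕ}
    {Ω : Type*} [MeasurableSpace Ω] (P : Measure Ω) [IsProbabilityMeasure P]
    (K : C(Set.Icc a b × Set.Icc a b, ℝ))
    (hKsymm : ∀ s t : Set.Icc a b, K (s, t) = K (t, s))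
    (Kop : (C(Set.Icc a b, ℝ) →L[ℝ] ℝ) →L[ℝ] C(Set.Icc a b, ℝ))
    (hKop : ∀ (μ : C(Set.Icc a b, ℝ) →L[ℝ] ℝ) (s : Set.Icc a b), Kop μ s = μ (K.curry s))
    (hpos : ∀ μ : C(Set.Icc a b, ℝ) →L[ℝ] ℝ, 0 ≤ μ (Kop μ))
    (hsym : ∀ μ ν : C(Set.Icc a b, ℝ) →L[ℝ] ℝ, μ (Kop ν) = ν (Kop μ))
    (Z : Ω → C(Set.Icc a b, ℝ))
    (hZmeas : ∀ ν : C(Set.Icc a b, ℝ) →L[ℝ] ℝ, Measurable fun ω => ν (Z ω))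
    (hZgauss : ∀ ν : C(Set.Icc a b, ℝ) →L[ℝ] ℝ,
      P.map (fun ω => ν (Z ω)) = gaussianReal 0 (Real.toNNReal (ν (Kop ν))))
    (hZcov : ∀ μ ν : C(Set.Icc a b, ℝ) →L[ℝ] ℝ,
      ∫ ω, μ (Z ω) * ν (Z ω) ∂P = μ (Kop ν))
    (Θ : Set (EuclideanSpace ℝ (Fin p))) (hΘc : IsCompact Θ) (hΘconv : Convex ℝ Θ)
    (θ₀ : EuclideanSpace ℝ (Fin p)) (hθ₀Θ : θ₀ ∈ Θ) (hθ₀ : θ₀ ∈ interior Θ)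
    (μf : EuclideanSpace ℝ (Fin p) → (C(Set.Icc a b, ℝ) →L[ℝ] ℝ))
    (hcont : ContinuousOn μf Θ)
    (hident : ∀ θ ∈ Θ, (∀ s : Set.Icc a b, Kop (μf θ) s = Kop (μf θ₀) s) → θ = θ₀)
    (Dμ : EuclideanSpace ℝ (Fin p) → Fin p → (C(Set.Icc a b, ℝ) →L[ℝ] ℝ))
    (D2μ : EuclideanSpace ℝ (Fin p) → Fin p → Fin p → (C(Set.Icc a b, ℝ) →L[ℝ] ℝ))
    (hD1 : ∀ θ ∈ Θ, HasFDerivWithinAt μf (clmOfPartials (Dμ θ)) Θ θ)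
    (hD2 : ∀ θ ∈ Θ, ∀ i, HasFDerivWithinAt (fun θ' => Dμ θ' i)
      (clmOfPartials (fun j => D2μ θ j i)) Θ θ)
    (hD2cont : UniformContinuousOn D2μ Θ)
    (Sig : Matrix (Fin p) (Fin p) ℝ)
    (hSigdef : ∀ i j, Sig i j = (Dμ θ₀ i) (Kop (Dμ θ₀ j)))
    (hSiginv : IsUnit Sig.det)
    (θhat : ℝ → Ω → EuclideanSpace ℝ (Fin p))
    (hθmeas : ∀ ε, Measurable (θhat ε))
    (hmem : ∀ ε > (0 : ℝ), ∀ ω, θhat ε ω ∈ Θ)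
    (hargmax : ∀ ε > (0 : ℝ), ∀ ω, ∀ θ ∈ Θ,
      (μf θ) (Kop (μf θ₀) + ε • Z ω) - (1 / 2) * (μf θ) (Kop (μf θ)) ≤
        (μf (θhat ε ω)) (Kop (μf θ₀) + ε • Z ω) -
          (1 / 2) * (μf (θhat ε ω)) (Kop (μf (θhat ε ω)))) :
    TendstoInMeasure P
        (fun (ε : ℝ) (ω : Ω) => fun i : Fin p => ε⁻¹ * (θhat ε ω i - θ₀ i))
        (𝓝[>] 0)
        (fun ω => Sig⁻¹.mulVec fun j => (Dμ θ₀ j) (Z ω)) ∧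
      ∀ u : Fin p → ℝ,
        P.map (fun ω => ∑ i, u i * (Sig⁻¹.mulVec fun j => (Dμ θ₀ j) (Z ω)) i) =
          gaussianReal 0 (Real.toNNReal (u ⬝ᵥ Sig⁻¹.mulVec u)) := by
  have hSigT : Sigᵀ = Sig := by
    ext i j
    rw [transpose_apply, hSigdef, hSigdef, hsym]
  have hSigInvT : Sig⁻¹ᵀ = Sig⁻¹ := by rw [transpose_nonsing_inv, hSigT]
  set D := clmOfPartials (Dμ θ₀) with hD
  have hgram := clmOfPartials_gram (Dμ θ₀) Kop hSigdef
  rw [← hD] at hgram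
  constructor
  · obtain ⟨B, hB⟩ : ∃ B : (C(Set.Icc a b, ℝ) →L[ℝ] ℝ) →L[ℝ] (C(Set.Icc a b, ℝ) →L[ℝ] ℝ) →L[ℝ] ℝ,
        ∀ μ ν, B μ ν = μ (Kop ν) :=
      ⟨(ContinuousLinearMap.compL ℝ (C(Set.Icc a b, ℝ) →L[ℝ] ℝ) C(Set.Icc a b, ℝ) ℝ).flip Kop,
        fun _ _ => rfl⟩
    have hBsymm : ∀ μ ν, B μ ν = B ν μ := fun μ ν => by rw [hB, hB, hsym]
    have hBnonneg : ∀ μ, 0 ≤ B μ μ := fun μ => (hB μ μ).symm ▸ hpos μ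
    have hf : HasFDerivAt μf D θ₀ :=
      (hD1 θ₀ hθ₀Θ).hasFDerivAt (mem_interior_iff_mem_nhds.1 hθ₀)
    have hgramInv : ∀ h, B (D (toEuclideanCLM (𝕜 := ℝ) Sig⁻¹ h)) (D h) = ‖h‖ ^ 2 := fun h => by
      rw [hB, hgram, ofLp_toEuclideanCLM, dotProduct_mulVec, ← mulVec_transpose, hSigT,
        mulVec_mulVec, mul_nonsing_inv _ hSiginv, one_mulVec, EuclideanSpace.real_norm_sq_eq]
      simp [dotProduct, sq]
    obtain ⟨c, hc, hcoer⟩ := exists_coercive_of_gram_inverse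
      (E := EuclideanSpace ℝ (Fin p)) (M := C(Set.Icc a b, ℝ) →L[ℝ] ℝ)
      hBsymm hBnonneg D (toEuclideanCLM (𝕜 := ℝ) Sig⁻¹) hgramInv
    have hbasic : ∀ ω, ∀ ε > 0, ∀ θ ∈ Θ,
        2 * ε * (μf θ - μf θ₀) (Z ω) - B (μf θ - μf θ₀) (μf θ - μf θ₀) ≤
          2 * ε * (μf (θhat ε ω) - μf θ₀) (Z ω) -
            B (μf (θhat ε ω) - μf θ₀) (μf (θhat ε ω) - μf θ₀) := by
      intro ω ε hε θ hθ
      have h := hargmax ε hε ω θ hθ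
      simp only [hB, map_sub, map_add, map_smul, smul_eq_mul, _root_.sub_apply,
        hsym (μf θ₀) (μf θ), hsym (μf θ₀) (μf (θhat ε ω))] at h ⊢
      linarith
    have hQ : ∀ θ ∈ Θ, B (μf θ - μf θ₀) (μf θ - μf θ₀) = 0 → θ = θ₀ := by
      refine fun θ hθ h0 => hident θ hθ fun s => ?_
      have hcs := sq_apply_le_of_symm_of_nonneg hBsymm hBnonneg
        (ContinuousMap.evalCLM ℝ s) (μf θ - μf θ₀)
      rw [h0, mul_zero] at hcs
      have : B (ContinuousMap.evalCLM ℝ s) (μf θ - μf θ₀) = 0 :=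
        pow_eq_zero_iff two_ne_zero |>.1 (hcs.antisymm (sq_nonneg _))
      rw [hB, map_sub] at this
      exact sub_eq_zero.1 this
    have hpointwise : ∀ ω, Tendsto (fun (ε : ℝ) => fun i : Fin p => ε⁻¹ * (θhat ε ω i - θ₀ i))
        (𝓝[>] 0) (𝓝 (Sig⁻¹.mulVec fun j => (Dμ θ₀ j) (Z ω))) := by
      intro ω
      have hu : ∀ h, B (D h) (D (WithLp.toLp 2 (Sig⁻¹.mulVec fun j => (Dμ θ₀ j) (Z ω)))) =
          ContinuousLinearMap.apply ℝ ℝ (Z ω) (D h) := fun h => by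
        rw [hB, hgram, mulVec_mulVec, mul_nonsing_inv _ hSiginv, one_mulVec,
          ContinuousLinearMap.apply_apply, hD, clmOfPartials_apply]
      have h := tendsto_rescaled_argmax_of_isCompact
        (E := EuclideanSpace ℝ (Fin p)) (M := C(Set.Icc a b, ℝ) →L[ℝ] ℝ) hBsymm hBnonneg hΘc
        (mem_interior_iff_mem_nhds.1 hθ₀) hcont hf hQ hc hcoer
        (ContinuousLinearMap.apply ℝ ℝ (Z ω)) hu (t := fun ε => θhat ε ω)
        (fun ε hε => hmem ε hε ω) (hbasic ω)
      exact ((PiLp.continuous_ofLp 2 _).tendsto _).comp h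
    intro δ hδ
    refine tendsto_of_seq_tendsto fun ε hε => ?_
    refine tendstoInMeasure_of_tendsto_ae (fun n => ?_)
      (Eventually.of_forall fun ω => (hpointwise ω).comp hε) δ hδ
    refine (measurable_pi_iff.2 fun i => ?_).aestronglyMeasurable
    exact (((EuclideanSpace.proj (𝕜 := ℝ) i).continuous.measurable.comp
      (hθmeas (ε n))).sub_const _).const_mul _
  · intro u
    have hν := hZgauss (D (WithLp.toLp 2 (Sig⁻¹ *ᵥ u)))
    rw [hgram, mulVec_mulVec, mul_nonsing_inv _ hSiginv, one_mulVec, dotProduct_comm] at hν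
    rw [← hν]
    congr 1
    ext ω
    rw [hD, clmOfPartials_apply]
    change u ⬝ᵥ Sig⁻¹ *ᵥ _ = (Sig⁻¹ *ᵥ u) ⬝ᵥ _
    rw [dotProduct_mulVec, ← mulVec_transpose, hSigInvT]
end
end

section
/- Local asymptotic normality at θ₀: Σ is symmetric positive definite; set φ(ε) := εΣ^{-1/2} and, for u ∈ ℝᵖ with θ₀ + φ(ε)u ∈ Θ, define the log-likelihood ratio Λ_ε(u) := ε⁻²(⟨μ_{θ₀+φ(ε)u} − μ_{θ₀}, X^ε − 𝒦μ_{θ₀}⟩ − (1/2)⟨μ_{θ₀+φ(ε)u} − μ_{θ₀}, 𝒦(μ_{θ₀+φ(ε)u} − μ_{θ₀})⟩). Then for every u ∈ ℝᵖ, Λ_ε(u) = uᵀΔ_{ε,θ₀} − (1/2)|u|² + o_p(1) as ε → 0, where Δ_{ε,θ₀} := Σ^{-1/2}(⟨∂_iμ_{θ₀}, ε⁻¹(X^ε − h₀)⟩)_{1≤i≤p} has the standard normal distribution N(0, I_p) on ℝᵖ for every ε > 0. -/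
open Filter MeasureTheory ProbabilityTheory Topology Matrix

noncomputable section

/-- The pairing `⟨∑ᵢ xᵢDᵢ, 𝒦 ∑ⱼ yⱼDⱼ⟩` is the bilinear form of the Gram matrix of `D`. -/
theorem sum_smul_apply_map_sum_smul {E : Type*} [NormedAddCommGroup E] [NormedSpace ℝ E]
    {p : ℕ} (Kop : (E →L[ℝ] ℝ) →L[ℝ] E) (D : Fin p → (E →L[ℝ] ℝ))
    (Sig : Matrix (Fin p) (Fin p) ℝ) (hSig : ∀ i j, Sig i j = D i (Kop (D j)))
    (x y : Fin p → ℝ) :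
    (∑ i, x i • D i) (Kop (∑ j, y j • D j)) = x ⬝ᵥ (Sig *ᵥ y) := by
  simp only [map_sum, map_smul, FunLike.coe_sum, Finset.sum_apply, FunLike.coe_smul,
    Pi.smul_apply, smul_eq_mul, dotProduct, mulVec, hSig, Finset.mul_sum]
  rw [Finset.sum_comm]
  exact Finset.sum_congr rfl fun i _ => Finset.sum_congr rfl fun j _ => by ring

/-- A symmetric square root `R` of `Sig⁻¹` satisfies `R * Sig * R = 1`, here as an identity of
quadratic forms. -/
theorem mulVec_dotProduct_mulVec_mulVec_of_mul_self_eq_inv {p : ℕ}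
    {Sig R : Matrix (Fin p) (Fin p) ℝ} (hSig : IsUnit Sig.det) (hR : R.IsSymm)
    (hRR : R * R = Sig⁻¹) (u : Fin p → ℝ) :
    (R *ᵥ u) ⬝ᵥ (Sig *ᵥ (R *ᵥ u)) = ∑ i, u i ^ 2 := by
  have h1 : R * (R * Sig) = 1 := by
    rw [← Matrix.mul_assoc, hRR, Matrix.nonsing_inv_mul _ hSig]
  have h2 : R * Sig * R = 1 := mul_eq_one_comm.mp h1
  have h3 : (R *ᵥ u) ⬝ᵥ (Sig *ᵥ (R *ᵥ u)) = u ⬝ᵥ ((R * Sig * R) *ᵥ u) := by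
    rw [← Matrix.mulVec_mulVec, ← Matrix.mulVec_mulVec, Matrix.dotProduct_mulVec u R,
      ← Matrix.mulVec_transpose, hR.eq]
  rw [h3, h2, Matrix.one_mulVec]
  simp [dotProduct, sq]

theorem dotProduct_mulVec_of_isSymm {p : ℕ} {R : Matrix (Fin p) (Fin p) ℝ} (hR : R.IsSymm)
    (v x : Fin p → ℝ) : ∑ i, v i * (R *ᵥ x) i = ∑ i, (R *ᵥ v) i * x i := by
  change v ⬝ᵥ (R *ᵥ x) = (R *ᵥ v) ⬝ᵥ x
  rw [Matrix.dotProduct_mulVec, ← Matrix.mulVec_transpose, hR.eq]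

/-- Centered Gaussian variables whose variances tend to zero, shifted by constants tending to
zero, tend to zero in measure. -/
theorem tendstoInMeasure_gaussian_add_const {Ω ι : Type*} [MeasurableSpace Ω] {P : Measure Ω}
    [IsProbabilityMeasure P] {l : Filter ι} {X : ι → Ω → ℝ} {σ c : ι → ℝ}
    (hX : ∀ i, Measurable (X i))
    (hlaw : ∀ i, P.map (X i) = gaussianReal 0 (Real.toNNReal (σ i)))
    (hσ : Tendsto σ l (𝓝 0)) (hc : Tendsto c l (𝓝 0)) :
    TendstoInMeasure P (fun i ω => X i ω + c i) l (fun _ => 0) := by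
  have hmem (i) : MemLp (X i) 2 P := by
    have h : MemLp id 2 (P.map (X i)) := by
      rw [hlaw i]; exact memLp_id_gaussianReal' 2 (by simp)
    exact h.comp_of_map (hX i).aemeasurable
  have hvar (i) : Var[X i; P] = (Real.toNNReal (σ i) : ℝ) := by
    have h := variance_map (μ := P) (X := id) (Y := X i) aemeasurable_id (hX i).aemeasurable
    rw [hlaw i, variance_id_gaussianReal] at h
    exact h.symm
  have hmean (i) : P[X i] = 0 := by
    have h := integral_map (μ := P) (φ := X i) (f := id) (hX i).aemeasurable
      aestronglyMeasurable_id
    rw [hlaw i] at h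
    simpa using h.symm
  have hnorm (i) : eLpNorm (X i) 2 P = ENNReal.ofReal (√(Real.toNNReal (σ i) : ℝ)) := by
    rw [(hmem i).eLpNorm_eq_integral_rpow_norm (by simp) (by simp), ← hvar i,
      variance_of_integral_eq_zero (hX i).aemeasurable (hmean i), Real.sqrt_eq_rpow]
    simp
  refine tendstoInMeasure_of_tendsto_eLpNorm (p := 2) (by simp)
    (fun i => ((hX i).add_const (c i)).aestronglyMeasurable) aestronglyMeasurable_const ?_
  have hbound : Tendsto (fun i => ENNReal.ofReal (√(Real.toNNReal (σ i) : ℝ))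
      + ENNReal.ofReal |c i|) l (𝓝 0) := by
    have h1 : Tendsto (fun i => √(Real.toNNReal (σ i) : ℝ)) l (𝓝 0) := by
      have hf : Continuous fun x : ℝ => √(Real.toNNReal x : ℝ) := by fun_prop
      simpa [Function.comp_def] using (hf.tendsto 0).comp hσ
    have h2 : Tendsto (fun i => |c i|) l (𝓝 0) := by simpa using hc.abs
    simpa using (ENNReal.tendsto_ofReal h1).add (ENNReal.tendsto_ofReal h2)
  refine tendsto_of_tendsto_of_tendsto_of_le_of_le tendsto_const_nhds hbound
    (fun _ => zero_le) fun i => ?_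
  have hle := eLpNorm_add_le (hX i).aestronglyMeasurable
    (aestronglyMeasurable_const (b := c i)) (μ := P) (p := 2) (by norm_num)
  have hconst : eLpNorm (fun _ : Ω => c i) 2 P = ENNReal.ofReal |c i| := by
    rw [eLpNorm_const _ (by simp) (IsProbabilityMeasure.ne_zero P)]
    simp [Real.enorm_eq_ofReal_abs]
  rw [hnorm i, hconst] at hle
  refine le_trans (le_of_eq ?_) hle
  congr 1
  ext ω
  simp

theorem HasFDerivWithinAt.tendsto_slope_smul_zero_right {E F : Type*} [NormedAddCommGroup E]
    [NormedSpace ℝ E] [NormedAddCommGroup F] [NormedSpace ℝ F] {f : E → F} {f' : E →L[ℝ] F}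
    {s : Set E} {x : E} (hf : HasFDerivWithinAt f f' s x) (hx : x ∈ interior s) (w : E) :
    Tendsto (fun t : ℝ => t⁻¹ • (f (x + t • w) - f x)) (𝓝[>] 0) (𝓝 (f' w)) := by
  have h := (hf.hasFDerivAt (mem_interior_iff_mem_nhds.mp hx)).hasLineDerivAt w
  simpa using HasDerivAt.tendsto_slope_zero_right h

/-- Theorem 3.16, local asymptotic normality at `θ₀`.
`Σᵢⱼ = ⟨∂ᵢμ_{θ₀}, 𝒦∂ⱼμ_{θ₀}⟩` is symmetric positive definite; with `φ(ε) = εΣ^{-1/2}`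
(`R = Σ^{-1/2}` being the positive definite square root of `Σ⁻¹`) and the log-likelihood
ratio `Λ_ε(u) = ε⁻²(⟨μ_{θ₀+φ(ε)u} − μ_{θ₀}, X^ε − 𝒦μ_{θ₀}⟩ −
½⟨μ_{θ₀+φ(ε)u} − μ_{θ₀}, 𝒦(μ_{θ₀+φ(ε)u} − μ_{θ₀})⟩)`, one has for every `u ∈ ℝᵖ`
`Λ_ε(u) = uᵀΔ_{ε,θ₀} − ½|u|² + o_p(1)` as `ε → 0`, where
`Δ_{ε,θ₀} = Σ^{-1/2}(⟨∂ᵢμ_{θ₀}, ε⁻¹(X^ε − h₀)⟩)ᵢ` has the standard normal distribution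
`N(0, I_p)` (every linear functional `v` of it is `N(0, |v|²)`) for every `ε > 0`. -/
theorem stmt8 {a b : ℝ} (hab : a < b) {p : ℕ}
    {Ω : Type*} [MeasurableSpace Ω] (P : Measure Ω) [IsProbabilityMeasure P]
    (K : C(Set.Icc a b × Set.Icc a b, ℝ))
    (hKsymm : ∀ s t : Set.Icc a b, K (s, t) = K (t, s))
    (Kop : (C(Set.Icc a b, ℝ) →L[ℝ] ℝ) →L[ℝ] C(Set.Icc a b, ℝ))
    (hKop : ∀ (μ : C(Set.Icc a b, ℝ) →L[ℝ] ℝ) (s : Set.Icc a b), Kop μ s = μ (K.curry s))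
    (hpos : ∀ μ : C(Set.Icc a b, ℝ) →L[ℝ] ℝ, 0 ≤ μ (Kop μ))
    (hsym : ∀ μ ν : C(Set.Icc a b, ℝ) →L[ℝ] ℝ, μ (Kop ν) = ν (Kop μ))
    (Z : Ω → C(Set.Icc a b, ℝ))
    (hZmeas : ∀ ν : C(Set.Icc a b, ℝ) →L[ℝ] ℝ, Measurable fun ω => ν (Z ω))
    (hZgauss : ∀ ν : C(Set.Icc a b, ℝ) →L[ℝ] ℝ,
      P.map (fun ω => ν (Z ω)) = gaussianReal 0 (Real.toNNReal (ν (Kop ν))))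
    (hZcov : ∀ μ ν : C(Set.Icc a b, ℝ) →L[ℝ] ℝ,
      ∫ ω, μ (Z ω) * ν (Z ω) ∂P = μ (Kop ν))
    (Θ : Set (EuclideanSpace ℝ (Fin p))) (hΘc : IsCompact Θ) (hΘconv : Convex ℝ Θ)
    (θ₀ : EuclideanSpace ℝ (Fin p)) (hθ₀Θ : θ₀ ∈ Θ) (hθ₀ : θ₀ ∈ interior Θ)
    (μf : EuclideanSpace ℝ (Fin p) → (C(Set.Icc a b, ℝ) →L[ℝ] ℝ))
    (hcont : ContinuousOn μf Θ)
    (hident : ∀ θ ∈ Θ, (∀ s : Set.Icc a b, Kop (μf θ) s = Kop (μf θ₀) s) → θ = θ₀)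
    (Dμ : EuclideanSpace ℝ (Fin p) → Fin p → (C(Set.Icc a b, ℝ) →L[ℝ] ℝ))
    (D2μ : EuclideanSpace ℝ (Fin p) → Fin p → Fin p → (C(Set.Icc a b, ℝ) →L[ℝ] ℝ))
    (hD1 : ∀ θ ∈ Θ, HasFDerivWithinAt μf (clmOfPartials (Dμ θ)) Θ θ)
    (hD2 : ∀ θ ∈ Θ, ∀ i, HasFDerivWithinAt (fun θ' => Dμ θ' i)
      (clmOfPartials (fun j => D2μ θ j i)) Θ θ)
    (hD2cont : UniformContinuousOn D2μ Θ)
    (Sig : Matrix (Fin p) (Fin p) ℝ)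
    (hSigdef : ∀ i j, Sig i j = (Dμ θ₀ i) (Kop (Dμ θ₀ j)))
    (hSiginv : IsUnit Sig.det) :
    Sig.IsSymm ∧ Sig.PosDef ∧
      ∀ R : Matrix (Fin p) (Fin p) ℝ, R.PosDef → R * R = Sig⁻¹ →
        (∀ ε > (0 : ℝ), ∀ v : Fin p → ℝ,
            P.map (fun ω =>
                ∑ i, v i *
                  (R.mulVec fun j =>
                    (Dμ θ₀ j) (ε⁻¹ • ((Kop (μf θ₀) + ε • Z ω) - Kop (μf θ₀)))) i) =
              gaussianReal 0 (Real.toNNReal (∑ i, v i ^ 2))) ∧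
          ∀ u : Fin p → ℝ,
            TendstoInMeasure P
              (fun (ε : ℝ) (ω : Ω) =>
                (fun θ' : EuclideanSpace ℝ (Fin p) =>
                    (ε ^ 2)⁻¹ *
                      ((μf θ' - μf θ₀) ((Kop (μf θ₀) + ε • Z ω) - Kop (μf θ₀)) -
                        (1 / 2) * (μf θ' - μf θ₀) (Kop (μf θ' - μf θ₀))))
                  (θ₀ + ε • (WithLp.equiv 2 (Fin p → ℝ)).symm (R.mulVec u)) -
                (∑ i, u i *
                    (R.mulVec fun j =>
                      (Dμ θ₀ j) (ε⁻¹ • ((Kop (μf θ₀) + ε • Z ω) - Kop (μf θ₀)))) i -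
                  (1 / 2) * ∑ i, u i ^ 2))
              (𝓝[>] 0) (fun _ω => 0) := by
  set D := Dμ θ₀ with hD
  have hSigform := sum_smul_apply_map_sum_smul Kop D Sig hSigdef
  have hsymm : Sig.IsSymm := by
    ext i j
    rw [Matrix.transpose_apply, hSigdef, hSigdef, hsym]
  have hpsd : Sig.PosSemidef := by
    refine .of_dotProduct_mulVec_nonneg ?_ fun x => ?_
    · rw [Matrix.IsHermitian, Matrix.conjTranspose_eq_transpose_of_trivial]
      exact hsymm
    · rw [star_trivial, ← hSigform]
      exact hpos _
  refine ⟨hsymm, hpsd.posDef_iff_isUnit.mpr ((Matrix.isUnit_iff_isUnit_det _).mpr hSiginv),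
    fun R hR hRR => ?_⟩
  have hRsymm : R.IsSymm := by
    have h := hR.isHermitian
    rwa [Matrix.IsHermitian, Matrix.conjTranspose_eq_transpose_of_trivial] at h
  have hquad (u : Fin p → ℝ) : (∑ i, (R *ᵥ u) i • D i) (Kop (∑ i, (R *ᵥ u) i • D i)) =
      ∑ i, u i ^ 2 := by
    rw [hSigform, mulVec_dotProduct_mulVec_mulVec_of_mul_self_eq_inv hSiginv hRsymm hRR]
  have hscore (ε : ℝ) (hε : 0 < ε) (ω : Ω) (v : Fin p → ℝ) :
      ∑ i, v i * (R *ᵥ fun j => D j (ε⁻¹ • ((Kop (μf θ₀) + ε • Z ω) - Kop (μf θ₀)))) i =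
        (∑ i, (R *ᵥ v) i • D i) (Z ω) := by
    rw [add_sub_cancel_left, inv_smul_smul₀ hε.ne', dotProduct_mulVec_of_isSymm hRsymm]
    simp
  refine ⟨fun ε hε v => ?_, fun u => ?_⟩
  · simp_rw [hscore ε hε]
    rw [hZgauss, hquad]
  · set w : EuclideanSpace ℝ (Fin p) := (WithLp.equiv 2 (Fin p → ℝ)).symm (R *ᵥ u) with hw
    set S := ∑ i, (R *ᵥ u) i • D i with hS
    have hSw : clmOfPartials D w = S := by
      simp [clmOfPartials, hS, hw]
    set A : ℝ → (C(Set.Icc a b, ℝ) →L[ℝ] ℝ) := fun ε => ε⁻¹ • (μf (θ₀ + ε • w) - μf θ₀)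
      with hA
    have hlim : Tendsto A (𝓝[>] 0) (𝓝 S) := by
      rw [← hSw]
      exact HasFDerivWithinAt.tendsto_slope_smul_zero_right (E := EuclideanSpace ℝ (Fin p))
        (F := C(Set.Icc a b, ℝ) →L[ℝ] ℝ) (hD1 θ₀ hθ₀Θ) hθ₀ w
    have hform : Continuous fun ν : C(Set.Icc a b, ℝ) →L[ℝ] ℝ => ν (Kop ν) := by fun_prop
    have hσ : Tendsto (fun ε => (A ε - S) (Kop (A ε - S))) (𝓝[>] 0) (𝓝 0) := by
      have h := (hform.tendsto (S - S)).comp (hlim.sub_const S)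
      rwa [sub_self, _root_.map_zero, _root_.map_zero] at h
    have hc : Tendsto (fun ε => -(1 / 2) * (A ε (Kop (A ε)) - ∑ i, u i ^ 2))
        (𝓝[>] 0) (𝓝 0) := by
      have h := (((hform.tendsto S).comp hlim).sub_const (∑ i, u i ^ 2)).const_mul (-(1 / 2))
      rw [hquad u, sub_self, mul_zero] at h
      exact h
    refine (tendstoInMeasure_gaussian_add_const (fun ε => hZmeas (A ε - S))
      (fun ε => hZgauss (A ε - S)) hσ hc).congr' ?_ .rfl
    filter_upwards [self_mem_nhdsWithin] with ε (hε : 0 < ε)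
    refine .of_forall fun ω => ?_
    beta_reduce
    rw [hscore ε hε ω u, add_sub_cancel_left]
    simp only [hA, map_smul, FunLike.coe_smul, FunLike.coe_sub, Pi.sub_apply, Pi.smul_apply,
      smul_eq_mul]
    have := hε.ne'
    field_simp
    ring
end
end

section
/- As ε → 0 and n → ∞ jointly (along any sequences ε_k → 0, n_k → ∞), θ̂_{n,ε} → θ₀ almost surely in ℝᵖ, μ_{θ̂_{n,ε}} → μ₀ almost surely in M(T) (total variation norm), and 𝒦μ_{θ̂_{n,ε}} → h₀ almost surely in C(T) (sup norm). -/
open Filter MeasureTheory ProbabilityTheory Topology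

noncomputable section

/-- The Dirac measure at `x`, as a bounded linear functional on `C([a,b])`. -/
def dirac {a b : ℝ} (x : Set.Icc a b) : C(Set.Icc a b, ℝ) →L[ℝ] ℝ :=
  LinearMap.mkContinuous
    { toFun := fun f => f x
      map_add' := by intro f g; simp
      map_smul' := by intro c f; simp }
    1 (fun f => by simpa using f.norm_coe_le_norm x)

/-- Continuous functions converging pointwise (as `k → ∞`) to the indicator of `[a,u]`. -/
def gbump (a b u : ℝ) (k : ℕ) : C(Set.Icc a b, ℝ) :=
  ⟨fun x => max 0 (min 1 (1 - k * (x.1 - u))), by fun_prop⟩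

/-- The coefficients `μ(Tᵢ)` of the discretization of `μ` with respect to the partition
`t n 0 < t n 1 < ⋯ < t n n`, expressed through the cumulative distribution function
`F μ u = μ([a,u])`:  `μ(T₁) = F μ (t n 1)` and `μ(Tᵢ) = F μ (t n i) − F μ (t n (i−1))`
for `i ≥ 2`. -/
def coef {a b : ℝ} (F : (C(Set.Icc a b, ℝ) →L[ℝ] ℝ) → ℝ → ℝ) (t : ℕ → ℕ → Set.Icc a b)
    (n : ℕ) (μ : C(Set.Icc a b, ℝ) →L[ℝ] ℝ) (i : ℕ) : ℝ :=
  if i = 1 then F μ (t n 1) else F μ (t n i) - F μ (t n (i - 1))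

/-- The discrete contrast
`Φₙ(μ; x) = ∑ᵢ μ(Tᵢ) x(tᵢ) − ½ ∑ᵢⱼ μ(Tᵢ)μ(Tⱼ)K(tᵢ,tⱼ)`. -/
def contrastD {a b : ℝ} (F : (C(Set.Icc a b, ℝ) →L[ℝ] ℝ) → ℝ → ℝ) (t : ℕ → ℕ → Set.Icc a b)
    (K : C(Set.Icc a b × Set.Icc a b, ℝ)) (n : ℕ)
    (μ : C(Set.Icc a b, ℝ) →L[ℝ] ℝ) (x : C(Set.Icc a b, ℝ)) : ℝ :=
  (∑ i ∈ Finset.Icc 1 n, coef F t n μ i * x (t n i)) -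
    (1 / 2) * ∑ i ∈ Finset.Icc 1 n, ∑ j ∈ Finset.Icc 1 n,
      coef F t n μ i * coef F t n μ j * K (t n i, t n j)

lemma gbump_mono {a b u v : ℝ} (h : u ≤ v) (k : ℕ) (s : Set.Icc a b) :
    gbump a b u k s ≤ gbump a b v k s := by
  have : (k : ℝ) * (s.1 - v) ≤ k * (s.1 - u) := by gcongr
  simp only [gbump, ContinuousMap.coe_mk]
  gcongr

lemma gbump_nonneg (a b u : ℝ) (k : ℕ) (s : Set.Icc a b) : 0 ≤ gbump a b u k s :=
  le_max_left _ _

lemma gbump_eq_one {a b u : ℝ} (k : ℕ) {s : Set.Icc a b} (h : s.1 ≤ u) :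
    gbump a b u k s = 1 := by
  have : (k : ℝ) * (s.1 - u) ≤ 0 :=
    mul_nonpos_of_nonneg_of_nonpos (Nat.cast_nonneg k) (by linarith)
  simp only [gbump, ContinuousMap.coe_mk]
  rw [min_eq_left (by linarith), max_eq_right zero_le_one]

lemma gbump_eq_zero {a b u : ℝ} {k : ℕ} {s : Set.Icc a b} (h : 1 ≤ k * (s.1 - u)) :
    gbump a b u k s = 0 := by
  simp only [gbump, ContinuousMap.coe_mk]
  exact max_eq_left ((min_le_right _ _).trans (by linarith))

/-- Continuous approximation of the indicator of the `i`-th cell of the `n`-th partition. -/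
def cellBump {a b : ℝ} (t : ℕ → ℕ → Set.Icc a b) (n i k : ℕ) : C(Set.Icc a b, ℝ) :=
  if i = 1 then gbump a b (t n 1) k else gbump a b (t n i) k - gbump a b (t n (i - 1)) k

lemma sum_Icc_ite_sub (g : ℕ → ℝ) {n : ℕ} (hn : 1 ≤ n) :
    ∑ i ∈ Finset.Icc 1 n, (if i = 1 then g 1 else g i - g (i - 1)) = g n := by
  induction n, hn using Nat.le_induction with
  | base => simp
  | succ m hm ih =>
    rw [Finset.sum_Icc_succ_top (by omega), ih, if_neg (by omega)]
    simp

lemma cellBump_apply {a b : ℝ} (t : ℕ → ℕ → Set.Icc a b) (n i k : ℕ) (s : Set.Icc a b) :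
    cellBump t n i k s = if i = 1 then gbump a b (t n 1) k s
      else gbump a b (t n i) k s - gbump a b (t n (i - 1)) k s := by
  unfold cellBump
  split_ifs <;> simp

/-- A weighted sum `∑ᵢ μ(Tᵢ) yᵢ` is close to `μ(x)` when each `yᵢ` is close to the values of `x`
near the `i`-th node. -/
lemma abs_sum_coef_mul_sub_le {a b : ℝ} {t : ℕ → ℕ → Set.Icc a b} {n : ℕ} (hn : 1 ≤ n)
    (ht0 : (t n 0 : ℝ) = a) (htlast : (t n n : ℝ) = b)
    (htmono : ∀ i < n, (t n i : ℝ) < (t n (i + 1) : ℝ))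
    {δ : ℝ} (hδ : 0 < δ) (hmesh : ∀ i < n, (t n (i + 1) : ℝ) - (t n i : ℝ) < δ)
    {F : (C(Set.Icc a b, ℝ) →L[ℝ] ℝ) → ℝ → ℝ}
    (hF : ∀ (μ : C(Set.Icc a b, ℝ) →L[ℝ] ℝ) (u : ℝ),
      Tendsto (fun k : ℕ => μ (gbump a b u k)) atTop (𝓝 (F μ u)))
    (μ : C(Set.Icc a b, ℝ) →L[ℝ] ℝ) (x : C(Set.Icc a b, ℝ)) (y : ℕ → ℝ) {C : ℝ} (hC : 0 ≤ C)
    (hxy : ∀ i ∈ Finset.Icc 1 n, ∀ s : Set.Icc a b, dist (t n i) s < 2 * δ → |y i - x s| ≤ C) :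
    |∑ i ∈ Finset.Icc 1 n, coef F t n μ i * y i - μ x| ≤ ‖μ‖ * C := by
  have hlim : Tendsto (fun k : ℕ => μ (∑ i ∈ Finset.Icc 1 n, y i • cellBump t n i k - x)) atTop
      (𝓝 (∑ i ∈ Finset.Icc 1 n, coef F t n μ i * y i - μ x)) := by
    simp only [map_sub, map_sum, map_smul, smul_eq_mul]
    refine (tendsto_finsetSum _ fun i _ => ?_).sub_const _
    simp only [mul_comm (y i)]
    refine Tendsto.mul_const _ ?_
    unfold cellBump coef
    split_ifs
    · exact hF μ _
    · simpa only [map_sub] using (hF μ _).sub (hF μ _)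
  refine le_of_tendsto hlim.abs ?_
  obtain ⟨k₀, hk₀⟩ := exists_nat_gt (1 / δ)
  filter_upwards [eventually_ge_atTop k₀] with k hk
  have hkδ : 1 < (k : ℝ) * δ := by
    rw [div_lt_iff₀ hδ] at hk₀
    refine hk₀.trans_le ?_
    gcongr
  refine (μ.le_opNorm _).trans ?_
  gcongr
  rw [ContinuousMap.norm_le _ hC]
  intro s
  have hprev : ∀ i ∈ Finset.Icc 1 n, (t n (i - 1) : ℝ) < t n i ∧
      (t n i : ℝ) - t n (i - 1) < δ := by
    intro i hi
    obtain ⟨h1, h2⟩ := Finset.mem_Icc.1 hi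
    obtain ⟨j, rfl⟩ : ∃ j, i = j + 1 := ⟨i - 1, by omega⟩
    exact ⟨htmono j (by omega), hmesh j (by omega)⟩
  have hsum : ∑ i ∈ Finset.Icc 1 n, cellBump t n i k s = 1 := by
    simp only [cellBump_apply]
    rw [sum_Icc_ite_sub (fun i => gbump a b (t n i) k s) hn]
    exact gbump_eq_one k (by rw [htlast]; exact s.2.2)
  have hnn : ∀ i ∈ Finset.Icc 1 n, 0 ≤ cellBump t n i k s := by
    intro i hi
    rw [cellBump_apply]
    split_ifs
    · exact gbump_nonneg ..
    · exact sub_nonneg.2 (gbump_mono (hprev i hi).1.le k s)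
  have heval : (∑ i ∈ Finset.Icc 1 n, y i • cellBump t n i k - x) s =
      ∑ i ∈ Finset.Icc 1 n, (y i - x s) * cellBump t n i k s := by
    simp only [sub_mul, Finset.sum_sub_distrib, ← Finset.mul_sum, hsum, mul_one]
    simp [ContinuousMap.sum_apply]
  rw [heval, Real.norm_eq_abs]
  calc |∑ i ∈ Finset.Icc 1 n, (y i - x s) * cellBump t n i k s|
      ≤ ∑ i ∈ Finset.Icc 1 n, |(y i - x s) * cellBump t n i k s| :=
        Finset.abs_sum_le_sum_abs _ _
    _ ≤ ∑ i ∈ Finset.Icc 1 n, C * cellBump t n i k s := by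
        refine Finset.sum_le_sum fun i hi => ?_
        rw [abs_mul, abs_of_nonneg (hnn i hi)]
        by_cases hfar : dist (t n i) s < 2 * δ
        · exact mul_le_mul_of_nonneg_right (hxy i hi s hfar) (hnn i hi)
        · have hzero : cellBump t n i k s = 0 := by
            have hp := hprev i hi
            rw [Subtype.dist_eq, Real.dist_eq, not_lt, le_abs] at hfar
            rw [cellBump_apply]
            rcases hfar with h | h
            · have hi1 : i ≠ 1 := by
                rintro rfl
                have := s.2.1
                simp only [Nat.sub_self, ht0] at hp
                linarith
              rw [if_neg hi1, gbump_eq_one k (by linarith), gbump_eq_one k (by linarith), sub_self]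
            · have h1 : 1 ≤ (k : ℝ) * (s.1 - t n i) :=
                hkδ.le.trans (by gcongr; linarith)
              have h2 : 1 ≤ (k : ℝ) * (s.1 - t n (i - 1)) :=
                hkδ.le.trans (by gcongr; linarith)
              split_ifs with hi1
              · subst hi1
                exact gbump_eq_zero h1
              · rw [gbump_eq_zero h1, gbump_eq_zero h2, sub_self]
          simp [hzero]
    _ = C := by rw [← Finset.mul_sum, hsum, mul_one]

/-- The discrete contrast is close to the continuous one, with an error controlled by the moduli of
continuity of `h` and `K`. -/
lemma abs_contrastD_sub_le {a b : ℝ} {t : ℕ → ℕ → Set.Icc a b} {n : ℕ} (hn : 1 ≤ n)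
    (ht0 : (t n 0 : ℝ) = a) (htlast : (t n n : ℝ) = b)
    (htmono : ∀ i < n, (t n i : ℝ) < (t n (i + 1) : ℝ))
    {δ : ℝ} (hδ : 0 < δ) (hmesh : ∀ i < n, (t n (i + 1) : ℝ) - (t n i : ℝ) < δ)
    {F : (C(Set.Icc a b, ℝ) →L[ℝ] ℝ) → ℝ → ℝ}
    (hF : ∀ (μ : C(Set.Icc a b, ℝ) →L[ℝ] ℝ) (u : ℝ),
      Tendsto (fun k : ℕ => μ (gbump a b u k)) atTop (𝓝 (F μ u)))
    {K : C(Set.Icc a b × Set.Icc a b, ℝ)}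
    {Kop : (C(Set.Icc a b, ℝ) →L[ℝ] ℝ) →L[ℝ] C(Set.Icc a b, ℝ)}
    (hKop : ∀ (μ : C(Set.Icc a b, ℝ) →L[ℝ] ℝ) (s : Set.Icc a b), Kop μ s = μ (K.curry s))
    (μ : C(Set.Icc a b, ℝ) →L[ℝ] ℝ) (h z : C(Set.Icc a b, ℝ)) {ε η : ℝ} (hε : 0 ≤ ε) (hη : 0 ≤ η)
    (hh : ∀ s s' : Set.Icc a b, dist s s' < 2 * δ → |h s - h s'| ≤ η)
    (hK : ∀ p p' : Set.Icc a b × Set.Icc a b, dist p p' < 2 * δ → |K p - K p'| ≤ η) :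
    |contrastD F t K n μ (h + ε • z) - (μ h - 1 / 2 * μ (Kop μ))| ≤
      ‖μ‖ * (η + ε * ‖z‖) + 1 / 2 * (‖μ‖ * (‖μ‖ * η)) := by
  have h1 := abs_sum_coef_mul_sub_le hn ht0 htlast htmono hδ hmesh hF μ h
    (fun i => (h + ε • z) (t n i)) (C := η + ε * ‖z‖) (by positivity) (by
      intro i _ s hs
      have hz : |ε * z (t n i)| ≤ ε * ‖z‖ := by
        rw [abs_mul, abs_of_nonneg hε]
        gcongr
        exact z.norm_coe_le_norm _
      calc |(h + ε • z) (t n i) - h s| = |(h (t n i) - h s) + ε * z (t n i)| := by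
            simp only [ContinuousMap.add_apply, ContinuousMap.smul_apply, smul_eq_mul]
            ring_nf
        _ ≤ _ := (abs_add_le _ _).trans (add_le_add (hh _ _ hs) hz))
  have h2 := abs_sum_coef_mul_sub_le hn ht0 htlast htmono hδ hmesh hF μ (Kop μ)
    (fun i => ∑ j ∈ Finset.Icc 1 n, coef F t n μ j * K (t n i, t n j)) (C := ‖μ‖ * η)
    (by positivity) (by
      intro i _ s hs
      rw [hKop]
      refine abs_sum_coef_mul_sub_le hn ht0 htlast htmono hδ hmesh hF μ (K.curry s) _ hη ?_
      intro j _ s' hs'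
      exact hK _ (s, s') (by rw [Prod.dist_eq]; exact max_lt hs hs'))
  have hsum : ∑ i ∈ Finset.Icc 1 n, ∑ j ∈ Finset.Icc 1 n,
      coef F t n μ i * coef F t n μ j * K (t n i, t n j) =
      ∑ i ∈ Finset.Icc 1 n, coef F t n μ i *
        ∑ j ∈ Finset.Icc 1 n, coef F t n μ j * K (t n i, t n j) := by
    simp only [Finset.mul_sum, mul_assoc]
  rw [contrastD, hsum]
  rw [abs_le] at h1 h2 ⊢
  constructor <;> linarith [h1.1, h1.2, h2.1, h2.2]

/-- A symmetric positive semidefinite operator vanishes where its quadratic form does. -/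
lemma map_eq_zero_of_quadratic_eq_zero {a b : ℝ}
    {Kop : (C(Set.Icc a b, ℝ) →L[ℝ] ℝ) →L[ℝ] C(Set.Icc a b, ℝ)}
    (hpos : ∀ μ : C(Set.Icc a b, ℝ) →L[ℝ] ℝ, 0 ≤ μ (Kop μ))
    (hsym : ∀ μ ν : C(Set.Icc a b, ℝ) →L[ℝ] ℝ, μ (Kop ν) = ν (Kop μ))
    {μ : C(Set.Icc a b, ℝ) →L[ℝ] ℝ} (hμ : μ (Kop μ) = 0) : Kop μ = 0 := by
  ext s
  change dirac s (Kop μ) = 0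
  set d := dirac s
  by_contra hne
  have hquad : ∀ r : ℝ, 0 ≤ 2 * r * d (Kop μ) + d (Kop d) := by
    intro r
    have h := hpos (r • μ + d)
    simp only [map_add, map_smul, add_apply, smul_apply,
      smul_eq_mul, hμ, hsym μ d] at h
    linarith
  have h := hquad (-(d (Kop d) + 1) / (2 * d (Kop μ)))
  have he : 2 * (-(d (Kop d) + 1) / (2 * d (Kop μ))) * d (Kop μ) = -(d (Kop d) + 1) := by
    field_simp
  linarith

/-- Theorem 3.18, consistency of the M-estimator under discrete
observations.  `Z` is a centered Gaussian random element of `C([a,b])` with covariance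
operator `Kop`, `X^ε = 𝒦μ_{θ₀} + εZ`, the partitions `t n 0 < ⋯ < t n n` of `[a,b]` have
vanishing mesh, and `θ̂_{n,ε}` maximizes the discrete contrast
`Φ_{n,ε}(θ) = ∑ᵢ μ_θ(Tᵢ) X^ε(tᵢ) − ½∑ᵢⱼ μ_θ(Tᵢ)μ_θ(Tⱼ)K(tᵢ,tⱼ)` over the compact `Θ`.
Then, almost surely, jointly as `n → ∞` and `ε → 0`: `θ̂_{n,ε} → θ₀` in `ℝᵖ`,
`μ_{θ̂_{n,ε}} → μ_{θ₀}` in `M(T)` and `𝒦μ_{θ̂_{n,ε}} → 𝒦μ_{θ₀}` in `C(T)`. -/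
theorem stmt9 {a b : ℝ} (hab : a < b) {p : ℕ}
    {Ω : Type*} [MeasurableSpace Ω] (P : Measure Ω) [IsProbabilityMeasure P]
    (K : C(Set.Icc a b × Set.Icc a b, ℝ))
    (hKsymm : ∀ s t : Set.Icc a b, K (s, t) = K (t, s))
    (Kop : (C(Set.Icc a b, ℝ) →L[ℝ] ℝ) →L[ℝ] C(Set.Icc a b, ℝ))
    (hKop : ∀ (μ : C(Set.Icc a b, ℝ) →L[ℝ] ℝ) (s : Set.Icc a b), Kop μ s = μ (K.curry s))
    (hpos : ∀ μ : C(Set.Icc a b, ℝ) →L[ℝ] ℝ, 0 ≤ μ (Kop μ))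
    (hsym : ∀ μ ν : C(Set.Icc a b, ℝ) →L[ℝ] ℝ, μ (Kop ν) = ν (Kop μ))
    (Z : Ω → C(Set.Icc a b, ℝ))
    (hZmeas : ∀ ν : C(Set.Icc a b, ℝ) →L[ℝ] ℝ, Measurable fun ω => ν (Z ω))
    (hZgauss : ∀ ν : C(Set.Icc a b, ℝ) →L[ℝ] ℝ,
      P.map (fun ω => ν (Z ω)) = gaussianReal 0 (Real.toNNReal (ν (Kop ν))))
    (hZcov : ∀ μ ν : C(Set.Icc a b, ℝ) →L[ℝ] ℝ,
      ∫ ω, μ (Z ω) * ν (Z ω) ∂P = μ (Kop ν))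
    (Θ : Set (Fin p → ℝ)) (hΘc : IsCompact Θ)
    (θ₀ : Fin p → ℝ) (hθ₀ : θ₀ ∈ Θ)
    (μf : (Fin p → ℝ) → (C(Set.Icc a b, ℝ) →L[ℝ] ℝ))
    (hcont : ContinuousOn μf Θ)
    (hident : ∀ θ ∈ Θ, (∀ s : Set.Icc a b, Kop (μf θ) s = Kop (μf θ₀) s) → θ = θ₀)
    -- the partitions `0 = t n 0 < t n 1 < ⋯ < t n n = max T` with vanishing mesh
    (t : ℕ → ℕ → Set.Icc a b)
    (ht0 : ∀ n, 1 ≤ n → (t n 0 : ℝ) = a)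
    (htlast : ∀ n, 1 ≤ n → (t n n : ℝ) = b)
    (htmono : ∀ n, 1 ≤ n → ∀ i < n, (t n i : ℝ) < (t n (i + 1) : ℝ))
    (hmesh : ∀ δ > (0 : ℝ), ∃ N, ∀ n ≥ N, ∀ i < n, (t n (i + 1) : ℝ) - (t n i : ℝ) < δ)
    -- `F μ u = μ([a,u])`, the cumulative distribution function of `μ`
    (F : (C(Set.Icc a b, ℝ) →L[ℝ] ℝ) → ℝ → ℝ)
    (hF : ∀ (μ : C(Set.Icc a b, ℝ) →L[ℝ] ℝ) (u : ℝ),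
      Tendsto (fun k : ℕ => μ (gbump a b u k)) atTop (𝓝 (F μ u)))
    -- the discrete M-estimator
    (θhat : ℕ → ℝ → Ω → (Fin p → ℝ))
    (hmem : ∀ n, 1 ≤ n → ∀ ε > (0 : ℝ), ∀ ω, θhat n ε ω ∈ Θ)
    (hargmax : ∀ n, 1 ≤ n → ∀ ε > (0 : ℝ), ∀ ω, ∀ θ ∈ Θ,
      contrastD F t K n (μf θ) (Kop (μf θ₀) + ε • Z ω) ≤
        contrastD F t K n (μf (θhat n ε ω)) (Kop (μf θ₀) + ε • Z ω)) :
    ∀ᵐ ω ∂P,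
      Tendsto (fun q : ℕ × ℝ => θhat q.1 q.2 ω) (atTop ×ˢ 𝓝[>] 0) (𝓝 θ₀) ∧
        Tendsto (fun q : ℕ × ℝ => μf (θhat q.1 q.2 ω)) (atTop ×ˢ 𝓝[>] 0) (𝓝 (μf θ₀)) ∧
          Tendsto (fun q : ℕ × ℝ => Kop (μf (θhat q.1 q.2 ω))) (atTop ×ˢ 𝓝[>] 0)
            (𝓝 (Kop (μf θ₀))) := by
  have hqcont : ContinuousOn (fun θ => (μf θ - μf θ₀) (Kop (μf θ - μf θ₀))) Θ := by
    have hsub : ContinuousOn (fun θ => μf θ - μf θ₀) Θ := hcont.sub continuousOn_const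
    exact hsub.clm_apply (Kop.continuous.comp_continuousOn hsub)
  have hqpos : ∀ θ ∈ Θ, θ ≠ θ₀ → 0 < (μf θ - μf θ₀) (Kop (μf θ - μf θ₀)) := by
    intro θ hθ hne
    refine lt_of_le_of_ne (hpos _) fun h0 => hne (hident θ hθ fun s => ?_)
    have h := map_eq_zero_of_quadratic_eq_zero hpos hsym h0.symm
    rw [map_sub, sub_eq_zero] at h
    rw [h]
  obtain ⟨M₀, hM₀⟩ := hΘc.exists_bound_of_continuousOn (E := C(Set.Icc a b, ℝ) →L[ℝ] ℝ) hcont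
  obtain ⟨M, hM1, hM⟩ : ∃ M : ℝ, 1 ≤ M ∧ ∀ θ ∈ Θ, ‖μf θ‖ ≤ M :=
    ⟨max 1 M₀, le_max_left _ _, fun θ hθ => (hM₀ θ hθ).trans (le_max_right _ _)⟩
  refine Eventually.of_forall fun ω => ?_
  have hpair : ∀ᶠ q : ℕ × ℝ in atTop ×ˢ 𝓝[>] 0, 1 ≤ q.1 ∧ 0 < q.2 :=
    (eventually_ge_atTop 1).prod_mk self_mem_nhdsWithin
  have hθlim : Tendsto (fun q : ℕ × ℝ => θhat q.1 q.2 ω) (atTop ×ˢ 𝓝[>] 0) (𝓝 θ₀) := by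
    rw [tendsto_nhds]
    intro U hU hθU
    obtain ⟨c, hc, hcq⟩ : ∃ c > 0, ∀ θ ∈ Θ \ U, c ≤ (μf θ - μf θ₀) (Kop (μf θ - μf θ₀)) := by
      rcases (Θ \ U).eq_empty_or_nonempty with he | hne
      · exact ⟨1, one_pos, by simp [he]⟩
      · obtain ⟨θ₁, hθ₁, hmin⟩ :=
          (hΘc.diff hU).exists_isMinOn hne (hqcont.mono Set.sdiff_subset)
        exact ⟨_, hqpos θ₁ hθ₁.1 fun h => hθ₁.2 (h ▸ hθU), fun θ hθ => hmin hθ⟩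
    set η : ℝ := c / (16 * (M + M * M)) with hηdef
    have hη : 0 < η := by positivity
    have hηM : η * (M + M * M) = c / 16 := by rw [hηdef]; field_simp
    obtain ⟨δ₁, hδ₁, hh⟩ := Metric.uniformContinuous_iff.1
      (CompactSpace.uniformContinuous_of_continuous (Kop (μf θ₀)).continuous) η hη
    obtain ⟨δ₂, hδ₂, hK⟩ := Metric.uniformContinuous_iff.1
      (CompactSpace.uniformContinuous_of_continuous K.continuous) η hη
    set δ : ℝ := min δ₁ δ₂ / 2 with hδdef
    have hδ : 0 < δ := by positivity
    have hδle₁ : 2 * δ ≤ δ₁ := by rw [hδdef]; linarith [min_le_left δ₁ δ₂]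
    have hδle₂ : 2 * δ ≤ δ₂ := by rw [hδdef]; linarith [min_le_right δ₁ δ₂]
    obtain ⟨N, hN⟩ := hmesh δ hδ
    have hεlim : Tendsto (fun ε : ℝ => M * (ε * ‖Z ω‖)) (𝓝[>] 0) (𝓝 0) := by
      have : Continuous fun ε : ℝ => M * (ε * ‖Z ω‖) := by fun_prop
      simpa using (this.tendsto 0).mono_left nhdsWithin_le_nhds
    have hεev : ∀ᶠ ε : ℝ in 𝓝[>] 0, M * (ε * ‖Z ω‖) < c / 16 :=
      hεlim.eventually_lt_const (by positivity)
    filter_upwards [hpair, (eventually_ge_atTop N).prod_mk hεev] with q hq hq'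
    obtain ⟨n, ε⟩ := q
    obtain ⟨hn, hε⟩ := hq
    obtain ⟨hnN, hεZ⟩ := hq'
    dsimp only at hn hε hnN hεZ ⊢
    have hclose : ∀ θ ∈ Θ, |contrastD F t K n (μf θ) (Kop (μf θ₀) + ε • Z ω) -
        (μf θ (Kop (μf θ₀)) - 1 / 2 * μf θ (Kop (μf θ)))| < c / 8 := by
      intro θ hθ
      refine (abs_contrastD_sub_le hn (ht0 n hn) (htlast n hn) (htmono n hn) hδ (hN n hnN) hF hKop
        (μf θ) (Kop (μf θ₀)) (Z ω) hε.le hη.le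
        (fun s s' hs => (hh (hs.trans_le hδle₁)).le)
        (fun p p' hp => (hK (hp.trans_le hδle₂)).le)).trans_lt ?_
      have hMθ := hM θ hθ
      calc ‖μf θ‖ * (η + ε * ‖Z ω‖) + 1 / 2 * (‖μf θ‖ * (‖μf θ‖ * η))
          ≤ M * (η + ε * ‖Z ω‖) + 1 / 2 * (M * (M * η)) := by gcongr
        _ < c / 8 := by
          have : 0 ≤ M * (M * η) := by positivity
          linarith
    by_contra hout
    have hmemθ := hmem n hn ε hε ω
    have hq := hcq _ ⟨hmemθ, hout⟩
    have hmax := hargmax n hn ε hε ω θ₀ hθ₀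
    have e1 := abs_lt.1 (hclose _ hmemθ)
    have e2 := abs_lt.1 (hclose _ hθ₀)
    simp only [map_sub, sub_apply] at hq
    linarith [e1.1, e1.2, e2.1, e2.2, hsym (μf θ₀) (μf (θhat n ε ω))]
  have hμlim : Tendsto (fun q : ℕ × ℝ => μf (θhat q.1 q.2 ω)) (atTop ×ˢ 𝓝[>] 0)
      (𝓝 (μf θ₀)) :=
    (hcont θ₀ hθ₀).tendsto.comp (tendsto_nhdsWithin_iff.2
      ⟨hθlim, hpair.mono fun q hq => hmem q.1 hq.1 q.2 hq.2 ω⟩)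
  exact ⟨hθlim, hμlim, (Kop.continuous.tendsto _).comp hμlim⟩
end
end
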